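/- Minimum bisection of sparse Erdős–Rényi graphs: for every ε > 0 there exists γ₀ < ∞ such that for every γ ≥ γ₀, if G ~ G(n, ⌊γn⌋) is a uniformly random simple graph on n vertices with ⌊γn⌋ edges, then P( |mcut(G)/n − (γ/2 − P_*·√(γ/2))| ≤ ε·√γ ) → 1 as n → ∞. (That is, w.h.p. mcut(G)/n = γ/2 − P_*√(γ/2) + o_γ(√γ).) -/

import Mathlib

open MeasureTheory Filter Finset

/-- The real value (±1) of a Boolean spin. -/
noncomputable def spin (b : Bool) : ℝ := if b then 1 else -1

/-- The Sherrington–Kirkpatrick Hamiltonian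
`H^SK_n(σ) = -(2n)^{-1/2} Σ_{i,j} J_{ij} σ_i σ_j`. -/
noncomputable def HSK (n : ℕ) (J : Fin n × Fin n → ℝ) (σ : Fin n → Bool) : ℝ :=
  -(Real.sqrt (2 * n))⁻¹ * ∑ p : Fin n × Fin n, J p * spin (σ p.1) * spin (σ p.2)

/-- The law of the i.i.d. standard Gaussian couplings `(J_{ij})`. -/
noncomputable def skMeasure (n : ℕ) : Measure ((Fin n × Fin n) → ℝ) :=
  Measure.pi fun _ => ProbabilityTheory.gaussianReal 0 1

open Classical in
/-- The cut size of the partition `(S, Sᶜ)` in the graph `G`. -/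
noncomputable def cutSize {n : ℕ} (G : SimpleGraph (Fin n)) (S : Finset (Fin n)) : ℕ :=
  ∑ i ∈ S, ∑ j ∈ Sᶜ, if G.Adj i j then 1 else 0

/-- `S` induces a bisection: the sizes of the two parts differ by at most one. -/
def IsBisection {n : ℕ} (S : Finset (Fin n)) : Prop :=
  (n : ℤ) - 1 ≤ 2 * S.card ∧ (2 * S.card : ℤ) ≤ n + 1

/-- Minimum bisection size. -/
noncomputable def mcut {n : ℕ} (G : SimpleGraph (Fin n)) : ℕ :=
  sInf {k : ℕ | ∃ S : Finset (Fin n), IsBisection S ∧ cutSize G S = k}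

/-- Probability that a uniformly random element of the (finite) set `A`
lies in the set `B`. -/
noncomputable def probUniform {α : Type*} (A B : Set α) : ℝ :=
  ((A ∩ B).ncard : ℝ) / (A.ncard : ℝ)


/-! Taylor expansion of the one-coordinate free energy -/

theorem taylor_aux (A B : ℝ) (hA : 0 ≤ A) (hB : 0 ≤ B) (hAB : 0 < A + B) :
    ∃ c0 c1 c2 : ℝ, ∀ u : ℝ,
      |Real.log (A * Real.exp u + B * Real.exp (-u)) - c0 - c1 * u - c2 * u ^ 2| ≤ 2 * |u| ^ 3 := by
  have hpos : ∀ u : ℝ, 0 < A * Real.exp u + B * Real.exp (-u) := by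
    intro u
    rcases hA.lt_or_eq with h | h
    · have := mul_pos h (Real.exp_pos u)
      have := mul_nonneg hB (Real.exp_pos (-u)).le
      linarith
    · have hB' : 0 < B := by linarith
      have := mul_pos hB' (Real.exp_pos (-u))
      rw [← h]; linarith
  set D : ℝ → ℝ := fun u => A * Real.exp u + B * Real.exp (-u) with hD
  set Nn : ℝ → ℝ := fun u => A * Real.exp u - B * Real.exp (-u) with hN
  have hexpn : ∀ u : ℝ, HasDerivAt (fun u : ℝ => Real.exp (-u)) (-Real.exp (-u)) u := by
    intro u
    simpa using (hasDerivAt_neg u).exp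
  have dD : ∀ u, HasDerivAt D (Nn u) u := by
    intro u
    have := ((Real.hasDerivAt_exp u).const_mul A).add ((hexpn u).const_mul B)
    exact this.congr_deriv (by simp only [hN]; ring)
  have dN : ∀ u, HasDerivAt Nn (D u) u := by
    intro u
    have := ((Real.hasDerivAt_exp u).const_mul A).sub ((hexpn u).const_mul B)
    exact this.congr_deriv (by simp only [hD]; ring)
  set y : ℝ → ℝ := fun u => Nn u / D u with hy
  have dy : ∀ u, HasDerivAt y (1 - y u ^ 2) u := by
    intro u
    have h := (dN u).div (dD u) (hpos u).ne'
    have h0 : D u ≠ 0 := (hpos u).ne'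
    exact h.congr_deriv (by simp only [hy]; field_simp)
  have dL : ∀ u, HasDerivAt (fun u => Real.log (D u)) (y u) u := fun u => (dD u).log (hpos u).ne'
  have hy1 : ∀ u, |y u| ≤ 1 := by
    intro u
    rw [hy, abs_div, abs_of_pos (hpos u : 0 < D u), div_le_one (hpos u)]
    have := mul_nonneg hA (Real.exp_pos u).le
    have := mul_nonneg hB (Real.exp_pos (-u)).le
    simp only [hN, hD]
    rw [abs_le]; constructor <;> linarith
  have hysq : ∀ u, |1 - y u ^ 2| ≤ 1 := by
    intro u
    have := sq_abs (y u)
    have h1 := hy1 u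
    have := abs_nonneg (y u)
    rw [abs_le]; constructor <;> nlinarith
  have mv : ∀ (f f' : ℝ → ℝ) (C u : ℝ), (∀ v, HasDerivAt f (f' v) v) → (∀ v, |v| ≤ |u| → |f' v| ≤ C) →
      |f u - f 0| ≤ C * |u| := by
    intro f f' C u hf hb
    have hc : Convex ℝ (Metric.closedBall (0:ℝ) |u|) := convex_closedBall 0 |u|
    have := hc.norm_image_sub_le_of_norm_hasDerivWithin_le (f := f) (f' := f') (C := C) (x := 0) (y := u)
      (fun v _ => (hf v).hasDerivWithinAt)
      (fun v hv => by
        rw [Real.norm_eq_abs]; apply hb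
        simpa using hv) (by simp) (by simp)
    simpa using this
  have s1 : ∀ u, |y u - y 0| ≤ 1 * |u| := fun u => mv y _ 1 u dy (fun v _ => hysq v)
  have s2 : ∀ u, |(y u - y 0 - (1 - y 0 ^ 2) * u)| ≤ (2 * |u|) * |u| := by
    intro u
    have := mv (fun v => y v - y 0 - (1 - y 0 ^ 2) * v) (fun v => (1 - y v ^ 2) - (1 - y 0 ^ 2)) (2 * |u|) u
      (fun v => by
        have := ((dy v).sub_const (y 0)).sub ((hasDerivAt_id v).const_mul (1 - y 0 ^ 2))
        exact this.congr_deriv (by simp))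
      (fun v hv => by
        have e : (1 - y v ^ 2) - (1 - y 0 ^ 2) = -((y v - y 0) * (y v + y 0)) := by ring
        rw [e, abs_neg, abs_mul]
        have h1 := s1 v
        have h2 : |y v + y 0| ≤ 2 := (abs_add_le _ _).trans (by linarith [hy1 v, hy1 0])
        have := abs_nonneg (y v - y 0)
        have := abs_nonneg (y v + y 0)
        have := abs_nonneg v
        nlinarith)
    simpa using this
  refine ⟨Real.log (D 0), y 0, (1 - y 0 ^ 2) / 2, fun u => ?_⟩
  have := mv (fun v => Real.log (D v) - Real.log (D 0) - y 0 * v - (1 - y 0 ^ 2) / 2 * v ^ 2)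
    (fun v => y v - y 0 - (1 - y 0 ^ 2) * v) (2 * |u| * |u|) u
    (fun v => by
      have := (((dL v).sub_const (Real.log (D 0))).sub ((hasDerivAt_id v).const_mul (y 0))).sub
        (((hasDerivAt_id v).pow 2).const_mul ((1 - y 0 ^ 2) / 2))
      exact this.congr_deriv (by simp; ring))
    (fun v hv => (s2 v).trans (by
        have := abs_nonneg v
        have := abs_nonneg u
        nlinarith))
  simp only [mul_zero, sub_self, ne_eq, OfNat.ofNat_ne_zero, not_false_eq_true, zero_pow, sub_zero] at this
  calc _ ≤ _ := this
    _ = _ := by ring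

/-! Replacing one coordinate of a product measure -/

theorem map_update_pi {ι : Type*} [Fintype ι] [DecidableEq ι] (μ : ι → Measure ℝ)
    [∀ i, IsProbabilityMeasure (μ i)] (e : ι) (κ : Measure ℝ) [IsProbabilityMeasure κ] :
    MeasurePreserving (fun q : (ι → ℝ) × ℝ => Function.update q.1 e q.2)
      ((Measure.pi μ).prod κ) (Measure.pi (Function.update μ e κ)) := by
  have hp : ∀ i, IsProbabilityMeasure (Function.update μ e κ i) := by
    intro i
    by_cases h : i = e
    · subst h; simpa
    · simp [h]; infer_instance
  have hm : Measurable (fun q : (ι → ℝ) × ℝ => Function.update q.1 e q.2) := by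
    rw [measurable_pi_iff]
    intro i
    by_cases h : i = e
    · subst h; simpa using measurable_snd
    · simp [h]; fun_prop
  refine ⟨hm, ?_⟩
  symm
  apply Measure.pi_eq
  intro s hs
  rw [Measure.map_apply hm (MeasurableSet.univ_pi hs)]
  have : (fun q : (ι → ℝ) × ℝ => Function.update q.1 e q.2) ⁻¹' (Set.univ.pi s)
      = (Set.univ.pi (Function.update s e Set.univ)) ×ˢ (s e) := by
    ext ⟨x, t⟩
    simp only [Set.mem_preimage, Set.mem_pi, Set.mem_univ, forall_const, Set.mem_prod]
    constructor
    · intro h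
      refine ⟨fun i => ?_, by simpa using h e⟩
      by_cases hi : i = e
      · subst hi; simp
      · simpa [hi] using h i
    · rintro ⟨h, h'⟩ i
      by_cases hi : i = e
      · subst hi; simpa
      · simpa [hi] using h i
  rw [this, Measure.prod_prod, Measure.pi_pi]
  rw [← Finset.mul_prod_erase univ _ (Finset.mem_univ e), ← Finset.mul_prod_erase univ
    (fun i => (Function.update μ e κ i) (s i)) (Finset.mem_univ e)]
  simp only [Function.update_self, measure_univ, one_mul]
  rw [mul_comm]
  congr 1
  apply Finset.prod_congr rfl
  intro i hi
  have : i ≠ e := (Finset.mem_erase.1 hi).1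
  simp [this]


noncomputable def lse {ι Ω : Type*} [Fintype ι] (W : Finset Ω) (s : Ω → ι → ℝ) (β : ℝ) (x : ι → ℝ) : ℝ :=
  Real.log (∑ σ ∈ W, Real.exp (β * ∑ i, s σ i * x i))

structure Mom (κ : Measure ℝ) (v m : ℝ) : Prop where
  prob : IsProbabilityMeasure κ
  int1 : Integrable (fun t : ℝ => t) κ
  int2 : Integrable (fun t : ℝ => t ^ 2) κ
  int3 : Integrable (fun t : ℝ => |t| ^ 3) κ
  mean : ∫ t, t ∂κ = 0
  var : ∫ t, t ^ 2 ∂κ = v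
  third : ∫ t, |t| ^ 3 ∂κ ≤ m

section
variable {ι Ω : Type*} [Fintype ι]

theorem lse_coord [DecidableEq ι] (W : Finset Ω) (hW : W.Nonempty) (s : Ω → ι → ℝ)
    (hs : ∀ σ i, s σ i = 1 ∨ s σ i = -1) (β : ℝ) (hβ : 0 ≤ β) (x : ι → ℝ) (e : ι) :
    ∃ c0 c1 c2 : ℝ, ∀ t : ℝ,
      |lse W s β (Function.update x e t) - c0 - c1 * t - c2 * t ^ 2| ≤ 2 * β ^ 3 * |t| ^ 3 := by
  classical
  set r : Ω → ℝ := fun σ => Real.exp (β * ∑ i ∈ univ.erase e, s σ i * x i) with hr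
  set A := ∑ σ ∈ W with s σ e = 1, r σ with hA
  set B := ∑ σ ∈ W with ¬ s σ e = 1, r σ with hB
  have hA0 : 0 ≤ A := Finset.sum_nonneg fun σ _ => (Real.exp_pos _).le
  have hB0 : 0 ≤ B := Finset.sum_nonneg fun σ _ => (Real.exp_pos _).le
  have hAB : 0 < A + B := by
    rw [hA, hB, Finset.sum_filter_add_sum_filter_not]
    exact Finset.sum_pos (fun σ _ => Real.exp_pos _) hW
  obtain ⟨c0, c1, c2, h⟩ := taylor_aux A B hA0 hB0 hAB
  refine ⟨c0, c1 * β, c2 * β ^ 2, fun t => ?_⟩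
  have key : lse W s β (Function.update x e t)
      = Real.log (A * Real.exp (β * t) + B * Real.exp (-(β * t))) := by
    unfold lse
    congr 1
    rw [← Finset.sum_filter_add_sum_filter_not W (fun σ => s σ e = 1), hA, hB,
      Finset.sum_mul, Finset.sum_mul]
    have h1 : ∀ σ, Real.exp (β * ∑ i, s σ i * Function.update x e t i)
        = r σ * Real.exp (s σ e * (β * t)) := by
      intro σ
      rw [hr, ← Real.exp_add, ← Finset.add_sum_erase univ _ (Finset.mem_univ e)]
      congr 1
      have : ∑ i ∈ univ.erase e, s σ i * Function.update x e t i
          = ∑ i ∈ univ.erase e, s σ i * x i := by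
        apply Finset.sum_congr rfl
        intro i hi
        rw [Function.update_of_ne (Finset.mem_erase.1 hi).1]
      rw [this, Function.update_self]
      ring
    congr 1
    · apply Finset.sum_congr rfl
      intro σ hσ
      rw [h1, (Finset.mem_filter.1 hσ).2, one_mul]
    · apply Finset.sum_congr rfl
      intro σ hσ
      rw [h1, (hs σ e).resolve_left (Finset.mem_filter.1 hσ).2]
      congr 2; ring
  rw [key]
  have := h (β * t)
  rw [abs_mul, abs_of_nonneg hβ] at this
  calc _ = |Real.log (A * Real.exp (β * t) + B * Real.exp (-(β * t))) - c0 - c1 * (β * t) - c2 * (β * t) ^ 2| := by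
        congr 1; ring
    _ ≤ _ := this
    _ = _ := by ring

theorem lse_cont (W : Finset Ω) (hW : W.Nonempty) (s : Ω → ι → ℝ) (β : ℝ) :
    Continuous (lse W s β) := by
  unfold lse
  apply Continuous.log
  · fun_prop
  · intro x
    exact (Finset.sum_pos (fun σ _ => Real.exp_pos _) hW).ne'

theorem lin_bound (s : ι → ℝ) (hs : ∀ i, s i = 1 ∨ s i = -1) (x : ι → ℝ) :
    |∑ i, s i * x i| ≤ ∑ i, |x i| := by
  refine (Finset.abs_sum_le_sum_abs _ _).trans (Finset.sum_le_sum fun i _ => ?_)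
  rw [abs_mul]
  rcases hs i with h | h <;> simp [h]

theorem lse_bound (W : Finset Ω) (hW : W.Nonempty) (s : Ω → ι → ℝ)
    (hs : ∀ σ i, s σ i = 1 ∨ s σ i = -1) (β : ℝ) (hβ : 0 ≤ β) (x : ι → ℝ) :
    |lse W s β x| ≤ Real.log W.card + β * ∑ i, |x i| := by
  have hc : (1:ℝ) ≤ W.card := by exact_mod_cast hW.card_pos
  have hl := Real.log_nonneg hc
  unfold lse
  have hb : ∀ σ, |β * ∑ i, s σ i * x i| ≤ β * ∑ i, |x i| := by
    intro σ
    rw [abs_mul, abs_of_nonneg hβ]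
    exact mul_le_mul_of_nonneg_left (lin_bound _ (hs σ) x) hβ
  have hpos : 0 < ∑ σ ∈ W, Real.exp (β * ∑ i, s σ i * x i) :=
    Finset.sum_pos (fun σ _ => Real.exp_pos _) hW
  rw [abs_le]
  constructor
  · obtain ⟨σ, hσ⟩ := hW
    have h1 : Real.exp (β * ∑ i, s σ i * x i) ≤ ∑ σ ∈ W, Real.exp (β * ∑ i, s σ i * x i) :=
      Finset.single_le_sum (f := fun σ => Real.exp (β * ∑ i, s σ i * x i))
        (fun σ _ => (Real.exp_pos _).le) hσ
    have h2 := Real.log_le_log (Real.exp_pos _) h1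
    rw [Real.log_exp] at h2
    have := (abs_le.1 (hb σ)).1
    linarith
  · have h1 : ∑ σ ∈ W, Real.exp (β * ∑ i, s σ i * x i) ≤ W.card * Real.exp (β * ∑ i, |x i|) := by
      rw [← nsmul_eq_mul]
      apply Finset.sum_le_card_nsmul
      intro σ _
      exact Real.exp_le_exp.2 (abs_le.1 (hb σ)).2
    have h2 := Real.log_le_log hpos h1
    rw [Real.log_mul (by linarith) (Real.exp_pos _).ne', Real.log_exp] at h2
    exact h2

theorem integrable_growth (μ : ι → Measure ℝ) [∀ i, IsProbabilityMeasure (μ i)]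
    (hμ : ∀ i, Integrable (fun t : ℝ => t) (μ i)) (f : (ι → ℝ) → ℝ) (hf : Continuous f) (C D : ℝ)
    (hb : ∀ x, |f x| ≤ C + D * ∑ i, |x i|) : Integrable f (Measure.pi μ) := by
  have h1 : Integrable (fun x : ι → ℝ => C + D * ∑ i, |x i|) (Measure.pi μ) := by
    refine (integrable_const C).add (Integrable.const_mul ?_ D)
    apply integrable_finsetSum
    intro i _
    exact integrable_comp_eval (μ := μ) (i := i) (f := fun t : ℝ => |t|) (hμ i).abs
  exact h1.mono' hf.aestronglyMeasurable (Eventually.of_forall hb)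

theorem one_dim (κ₁ κ₂ : Measure ℝ) (v m₁ m₂ : ℝ) (h₁ : Mom κ₁ v m₁) (h₂ : Mom κ₂ v m₂)
    (g : ℝ → ℝ) (c0 c1 c2 C : ℝ) (hC : 0 ≤ C) (g1 : Integrable g κ₁) (g2 : Integrable g κ₂)
    (hg : ∀ t, |g t - c0 - c1 * t - c2 * t ^ 2| ≤ C * |t| ^ 3) :
    |∫ t, g t ∂κ₁ - ∫ t, g t ∂κ₂| ≤ C * (m₁ + m₂) := by
  have main : ∀ (κ : Measure ℝ) (m : ℝ), Mom κ v m → Integrable g κ →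
      |∫ t, g t ∂κ - (c0 + c2 * v)| ≤ C * m := by
    intro κ m h gi
    have := h.prob
    have i1 : Integrable (fun t : ℝ => g t - c0) κ := gi.sub (integrable_const _)
    have i2 : Integrable (fun t : ℝ => g t - c0 - c1 * t) κ := i1.sub (h.int1.const_mul c1)
    have e : ∫ t, (g t - c0 - c1 * t - c2 * t ^ 2) ∂κ = ∫ t, g t ∂κ - (c0 + c2 * v) := by
      rw [integral_sub i2 (h.int2.const_mul c2), integral_sub i1 (h.int1.const_mul c1),
        integral_sub gi (integrable_const _), integral_const_mul, integral_const_mul, h.mean, h.var]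
      simp; ring
    rw [← e]
    calc |∫ t, (g t - c0 - c1 * t - c2 * t ^ 2) ∂κ| ≤ ∫ t, C * |t| ^ 3 ∂κ := by
          have := norm_integral_le_of_norm_le (f := fun t => g t - c0 - c1 * t - c2 * t ^ 2) (h.int3.const_mul C) (Eventually.of_forall hg)
          exact this
      _ = C * ∫ t, |t| ^ 3 ∂κ := integral_const_mul _ _
      _ ≤ C * m := mul_le_mul_of_nonneg_left h.third hC
  have a := abs_le.1 (main κ₁ m₁ h₁ g1)
  have b := abs_le.1 (main κ₂ m₂ h₂ g2)
  rw [abs_le]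
  constructor <;> linarith [a.1, a.2, b.1, b.2]

theorem swap_one [DecidableEq ι] (W : Finset Ω) (hW : W.Nonempty) (s : Ω → ι → ℝ)
    (hs : ∀ σ i, s σ i = 1 ∨ s σ i = -1) (β : ℝ) (hβ : 0 ≤ β)
    (μ : ι → Measure ℝ) (hμp : ∀ i, IsProbabilityMeasure (μ i))
    (hμ : ∀ i, Integrable (fun t : ℝ => t) (μ i))
    (κ₁ κ₂ : Measure ℝ) (v m₁ m₂ : ℝ) (h₁ : Mom κ₁ v m₁) (h₂ : Mom κ₂ v m₂) (e : ι) :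
    |∫ x, lse W s β x ∂(Measure.pi (Function.update μ e κ₁)) -
      ∫ x, lse W s β x ∂(Measure.pi (Function.update μ e κ₂))| ≤ 2 * β ^ 3 * (m₁ + m₂) := by
  have main : ∀ (κ : Measure ℝ) (m : ℝ), Mom κ v m →
      Integrable (fun q : (ι → ℝ) × ℝ => lse W s β (Function.update q.1 e q.2)) ((Measure.pi μ).prod κ) ∧
      ∫ x, lse W s β x ∂(Measure.pi (Function.update μ e κ))
        = ∫ x, ∫ t, lse W s β (Function.update x e t) ∂κ ∂(Measure.pi μ) := by
    intro κ m h
    have := h.prob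
    have mp := map_update_pi μ e κ
    have hp : ∀ i, IsProbabilityMeasure (Function.update μ e κ i) := by
      intro i
      by_cases h : i = e
      · subst h; simpa
      · simp [h]; infer_instance
    have hi : ∀ i, Integrable (fun t : ℝ => t) (Function.update μ e κ i) := by
      intro i
      by_cases hie : i = e
      · subst hie; simpa using h.int1
      · simpa [hie] using hμ i
    have I := integrable_growth (Function.update μ e κ) hi (lse W s β) (lse_cont W hW s β) _ _
      (lse_bound W hW s hs β hβ)
    have I2 : Integrable (fun q : (ι → ℝ) × ℝ => lse W s β (Function.update q.1 e q.2))
      ((Measure.pi μ).prod κ) := mp.integrable_comp_of_integrable I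
    refine ⟨I2, ?_⟩
    rw [← integral_prod _ I2]
    rw [← mp.map_eq, integral_map mp.measurable.aemeasurable]
    rw [mp.map_eq]
    exact I.aestronglyMeasurable
  obtain ⟨I1, e1⟩ := main κ₁ m₁ h₁
  obtain ⟨I2, e2⟩ := main κ₂ m₂ h₂
  have p1 := h₁.prob
  have p2 := h₂.prob
  rw [e1, e2, ← integral_sub I1.integral_prod_left I2.integral_prod_left]
  have hcoord : ∀ (κ : Measure ℝ) (m : ℝ), Mom κ v m → ∀ x : ι → ℝ,
      Integrable (fun t => lse W s β (Function.update x e t)) κ := by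
    intro κ m h x
    have := h.prob
    have hu : Continuous (fun t : ℝ => Function.update x e t) := by fun_prop
    have : Integrable (fun t : ℝ => (Real.log W.card + β * ∑ i, |x i|) + β * |t|) κ :=
      (integrable_const _).add (h.int1.abs.const_mul β)
    refine this.mono' ((lse_cont W hW s β).comp hu).aestronglyMeasurable (Eventually.of_forall fun t => ?_)
    refine (lse_bound W hW s hs β hβ _).trans ?_
    rw [add_assoc, ← mul_add]
    have : ∑ i, |Function.update x e t i| ≤ ∑ i, |x i| + |t| := by
      rw [← Finset.add_sum_erase univ _ (Finset.mem_univ e), Function.update_self, add_comm]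
      gcongr
      refine le_trans (le_of_eq ?_) (Finset.sum_le_sum_of_subset_of_nonneg (Finset.erase_subset e univ) (fun i _ _ => abs_nonneg (x i)))
      apply Finset.sum_congr rfl
      intro i hi
      rw [Function.update_of_ne (Finset.mem_erase.1 hi).1]
    gcongr
  have := norm_integral_le_of_norm_le_const (μ := Measure.pi μ) (C := 2 * β ^ 3 * (m₁ + m₂))
    (f := fun x => ∫ t, lse W s β (Function.update x e t) ∂κ₁ - ∫ t, lse W s β (Function.update x e t) ∂κ₂)
    (Eventually.of_forall fun x => by
      obtain ⟨c0, c1, c2, h⟩ := lse_coord W hW s hs β hβ x e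
      exact one_dim κ₁ κ₂ v m₁ m₂ h₁ h₂ _ c0 c1 c2 _ (by positivity) (hcoord κ₁ m₁ h₁ x)
        (hcoord κ₂ m₂ h₂ x) h)
  simpa using this

theorem lindeberg (W : Finset Ω) (hW : W.Nonempty) (s : Ω → ι → ℝ)
    (hs : ∀ σ i, s σ i = 1 ∨ s σ i = -1) (β : ℝ) (hβ : 0 ≤ β)
    (κ₁ κ₂ : Measure ℝ) (v m₁ m₂ : ℝ) (h₁ : Mom κ₁ v m₁) (h₂ : Mom κ₂ v m₂) :
    |∫ x, lse W s β x ∂(Measure.pi (fun _ : ι => κ₁)) -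
      ∫ x, lse W s β x ∂(Measure.pi (fun _ : ι => κ₂))| ≤ Fintype.card ι * (2 * β ^ 3 * (m₁ + m₂)) := by
  classical
  have main : ∀ S : Finset ι,
      |∫ x, lse W s β x ∂(Measure.pi (fun _ : ι => κ₁)) -
      ∫ x, lse W s β x ∂(Measure.pi (S.piecewise (fun _ : ι => κ₂) (fun _ : ι => κ₁)))|
        ≤ S.card * (2 * β ^ 3 * (m₁ + m₂)) := by
    intro S
    induction S using Finset.induction_on with
    | empty => simp
    | insert e S he ih =>
      rw [Finset.piecewise_insert, Finset.card_insert_of_notMem he]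
      set μ : ι → Measure ℝ := S.piecewise (fun _ : ι => κ₂) (fun _ : ι => κ₁) with hμ
      have p1 := h₁.prob
      have p2 := h₂.prob
      have hp : ∀ i, IsProbabilityMeasure (μ i) := by
        intro i; simp only [hμ, Finset.piecewise]; split_ifs <;> infer_instance
      have hi : ∀ i, Integrable (fun t : ℝ => t) (μ i) := by
        intro i; simp only [hμ, Finset.piecewise]; split_ifs
        · exact h₂.int1
        · exact h₁.int1
      have sw := swap_one W hW s hs β hβ μ hp hi κ₁ κ₂ v m₁ m₂ h₁ h₂ e
      have e1 : Function.update μ e κ₁ = μ := by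
        rw [Function.update_eq_self_iff]; simp [hμ, he]
      rw [e1] at sw
      push_cast
      have := abs_sub_le (∫ x, lse W s β x ∂(Measure.pi (fun _ : ι => κ₁)))
        (∫ x, lse W s β x ∂(Measure.pi μ)) (∫ x, lse W s β x ∂(Measure.pi (Function.update μ e κ₂)))
      linarith
  have := main univ
  simpa using this
end


/-- maximum of a finite family of linear forms -/
noncomputable def mx {ι Ω : Type*} [Fintype ι] (W : Finset Ω) (hW : W.Nonempty) (s : Ω → ι → ℝ)
    (x : ι → ℝ) : ℝ := W.sup' hW (fun σ => ∑ i, s σ i * x i)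

section
variable {ι Ω : Type*} [Fintype ι]

theorem le_mx (W : Finset Ω) (hW : W.Nonempty) (s : Ω → ι → ℝ) (x : ι → ℝ) (σ : Ω) (hσ : σ ∈ W) :
    ∑ i, s σ i * x i ≤ mx W hW s x :=
  Finset.le_sup' (fun σ => ∑ i, s σ i * x i) hσ

theorem exists_mx (W : Finset Ω) (hW : W.Nonempty) (s : Ω → ι → ℝ) (x : ι → ℝ) :
    ∃ σ ∈ W, mx W hW s x = ∑ i, s σ i * x i :=
  Finset.exists_mem_eq_sup' hW (fun σ => ∑ i, s σ i * x i)

theorem mx_cont (W : Finset Ω) (hW : W.Nonempty) (s : Ω → ι → ℝ) : Continuous (mx W hW s) := by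
  unfold mx
  apply Continuous.finset_sup'_apply
  intro σ _
  fun_prop

theorem mx_bound (W : Finset Ω) (hW : W.Nonempty) (s : Ω → ι → ℝ)
    (hs : ∀ σ i, s σ i = 1 ∨ s σ i = -1) (x : ι → ℝ) : |mx W hW s x| ≤ 0 + 1 * ∑ i, |x i| := by
  obtain ⟨σ, _, h⟩ := exists_mx W hW s x
  rw [h, zero_add, one_mul]
  exact lin_bound _ (hs σ) x

theorem mx_le_lse (W : Finset Ω) (hW : W.Nonempty) (s : Ω → ι → ℝ) (β : ℝ) (x : ι → ℝ) :
    β * mx W hW s x ≤ lse W s β x := by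
  obtain ⟨σ, hσ, h⟩ := exists_mx W hW s x
  rw [h, lse, Real.le_log_iff_exp_le (Finset.sum_pos (fun σ _ => Real.exp_pos _) hW)]
  exact Finset.single_le_sum (f := fun σ => Real.exp (β * ∑ i, s σ i * x i))
        (fun σ _ => (Real.exp_pos _).le) hσ

theorem lse_le_mx (W : Finset Ω) (hW : W.Nonempty) (s : Ω → ι → ℝ) (β : ℝ) (hβ : 0 ≤ β) (x : ι → ℝ) :
    lse W s β x ≤ Real.log W.card + β * mx W hW s x := by
  have hpos : 0 < ∑ σ ∈ W, Real.exp (β * ∑ i, s σ i * x i) :=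
    Finset.sum_pos (fun σ _ => Real.exp_pos _) hW
  have hc : (0:ℝ) < W.card := by exact_mod_cast hW.card_pos
  have h1 : ∑ σ ∈ W, Real.exp (β * ∑ i, s σ i * x i) ≤ W.card * Real.exp (β * mx W hW s x) := by
    rw [← nsmul_eq_mul]
    apply Finset.sum_le_card_nsmul
    intro σ hσ
    exact Real.exp_le_exp.2 (mul_le_mul_of_nonneg_left (le_mx W hW s x σ hσ) hβ)
  have h2 := Real.log_le_log hpos h1
  rw [Real.log_mul hc.ne' (Real.exp_pos _).ne', Real.log_exp] at h2
  exact h2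

theorem integrable_mx (W : Finset Ω) (hW : W.Nonempty) (s : Ω → ι → ℝ)
    (hs : ∀ σ i, s σ i = 1 ∨ s σ i = -1) (κ : Measure ℝ) (v m : ℝ) (h : Mom κ v m) :
    Integrable (mx W hW s) (Measure.pi (fun _ : ι => κ)) := by
  have := h.prob
  exact integrable_growth _ (fun _ => h.int1) _ (mx_cont W hW s) _ _ (mx_bound W hW s hs)

theorem integral_mx_lse (W : Finset Ω) (hW : W.Nonempty) (s : Ω → ι → ℝ)
    (hs : ∀ σ i, s σ i = 1 ∨ s σ i = -1) (β : ℝ) (hβ : 0 ≤ β) (κ : Measure ℝ) (v m : ℝ) (h : Mom κ v m) :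
    β * ∫ x, mx W hW s x ∂(Measure.pi (fun _ : ι => κ)) ≤ ∫ x, lse W s β x ∂(Measure.pi (fun _ : ι => κ)) ∧
    ∫ x, lse W s β x ∂(Measure.pi (fun _ : ι => κ)) ≤
      Real.log W.card + β * ∫ x, mx W hW s x ∂(Measure.pi (fun _ : ι => κ)) := by
  have := h.prob
  have i1 := integrable_mx W hW s hs κ v m h
  have i2 := integrable_growth (fun _ : ι => κ) (fun _ => h.int1) _ (lse_cont W hW s β) _ _
    (lse_bound W hW s hs β hβ)
  constructor
  · rw [← integral_const_mul]
    exact integral_mono (i1.const_mul β) i2 (fun x => mx_le_lse W hW s β x)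
  · have e : ∫ x, (Real.log W.card + β * mx W hW s x) ∂(Measure.pi (fun _ : ι => κ)) =
      Real.log W.card + β * ∫ x, mx W hW s x ∂(Measure.pi (fun _ : ι => κ)) := by
      rw [integral_add (integrable_const _) (i1.const_mul β), integral_const_mul]
      simp
    rw [← e]
    exact integral_mono i2 ((integrable_const _).add (i1.const_mul β)) (fun x => lse_le_mx W hW s β hβ x)

theorem universality (W : Finset Ω) (hW : W.Nonempty) (s : Ω → ι → ℝ)
    (hs : ∀ σ i, s σ i = 1 ∨ s σ i = -1) (β : ℝ) (hβ : 0 < β)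
    (κ₁ κ₂ : Measure ℝ) (v m₁ m₂ : ℝ) (h₁ : Mom κ₁ v m₁) (h₂ : Mom κ₂ v m₂) :
    |∫ x, mx W hW s x ∂(Measure.pi (fun _ : ι => κ₁)) -
      ∫ x, mx W hW s x ∂(Measure.pi (fun _ : ι => κ₂))| ≤
        Real.log W.card / β + Fintype.card ι * (2 * β ^ 2 * (m₁ + m₂)) := by
  have l := abs_le.1 (lindeberg W hW s hs β hβ.le κ₁ κ₂ v m₁ m₂ h₁ h₂)
  obtain ⟨a1, a2⟩ := integral_mx_lse W hW s hs β hβ.le κ₁ v m₁ h₁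
  obtain ⟨b1, b2⟩ := integral_mx_lse W hW s hs β hβ.le κ₂ v m₂ h₂
  have e : Real.log W.card / β + Fintype.card ι * (2 * β ^ 2 * (m₁ + m₂))
     = (Real.log W.card + Fintype.card ι * (2 * β ^ 3 * (m₁ + m₂))) / β := by
    field_simp
  rw [e, le_div_iff₀ hβ, mul_comm, ← abs_of_pos hβ, ← abs_mul, abs_of_pos hβ, mul_sub, abs_le]
  constructor <;> linarith [l.1, l.2]
end

/-! Edges -/

abbrev Ed (n : ℕ) := {p : Fin n × Fin n // p.1 < p.2}

theorem sum_pairs {n : ℕ} (f : Fin n × Fin n → ℝ) :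
    ∑ p, f p = ∑ e : Ed n, (f e.1 + f e.1.swap) + ∑ i, f (i, i) := by
  have h1 : ∑ p, f p = ∑ p with p.1 < p.2, f p + ∑ p with p.2 < p.1, f p + ∑ p with p.1 = p.2, f p := by
    rw [← Finset.sum_filter_add_sum_filter_not univ (fun p : Fin n × Fin n => p.1 = p.2)]
    rw [add_comm]
    congr 1
    rw [← Finset.sum_filter_add_sum_filter_not (univ.filter fun p : Fin n × Fin n => ¬ p.1 = p.2) (fun p => p.1 < p.2)]
    rw [Finset.filter_filter, Finset.filter_filter]
    congr 1
    · apply Finset.sum_congr _ (fun _ _ => rfl)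
      ext p; simp only [mem_filter, mem_univ, true_and]; omega
    · apply Finset.sum_congr _ (fun _ _ => rfl)
      ext p; simp only [mem_filter, mem_univ, true_and]; omega
  rw [h1, Finset.sum_add_distrib]
  congr 1
  · congr 1
    · rw [Finset.sum_subtype (univ.filter fun p : Fin n × Fin n => p.1 < p.2) (p := fun p => p.1 < p.2) (by simp)]
    · rw [← Finset.sum_subtype (univ.filter fun p : Fin n × Fin n => p.1 < p.2) (p := fun p => p.1 < p.2) (by simp)
        (fun p => f p.swap)]
      apply Finset.sum_nbij' (i := Prod.swap) (j := Prod.swap) <;> simp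
  · apply Finset.sum_nbij' (i := Prod.fst) (j := fun i => (i, i)) <;> simp

theorem card_Ed (n : ℕ) : (Fintype.card (Ed n) : ℝ) = n * (n - 1) / 2 := by
  have := sum_pairs (n := n) (fun _ => (1:ℝ))
  simp at this
  linarith

/-- spin product along an edge -/
noncomputable def se {n : ℕ} (σ : Fin n → Bool) (e : Ed n) : ℝ := spin (σ e.1.1) * spin (σ e.1.2)

theorem spin_cases (b : Bool) : spin b = 1 ∨ spin b = -1 := by cases b <;> simp [spin]
theorem spin_sq (b : Bool) : spin b * spin b = 1 := by cases b <;> simp [spin]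
theorem se_cases {n : ℕ} (σ : Fin n → Bool) (e : Ed n) : se σ e = 1 ∨ se σ e = -1 := by
  unfold se
  rcases spin_cases (σ e.1.1) with h | h <;> rcases spin_cases (σ e.1.2) with h' | h' <;> simp [h, h']

theorem sum_se {n : ℕ} (σ : Fin n → Bool) : ∑ e, se σ e = ((∑ i, spin (σ i)) ^ 2 - n) / 2 := by
  have := sum_pairs (n := n) (fun p => spin (σ p.1) * spin (σ p.2))
  simp only [spin_sq, Prod.fst_swap, Prod.snd_swap] at this
  rw [Fintype.sum_prod_type] at this
  rw [sq, Finset.sum_mul_sum, this]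
  simp only [se]
  rw [Finset.sum_add_distrib]
  have : ∑ e : Ed n, spin (σ e.1.2) * spin (σ e.1.1) = ∑ e : Ed n, spin (σ e.1.1) * spin (σ e.1.2) :=
    Finset.sum_congr rfl fun _ _ => mul_comm _ _
  rw [this]
  simp

open Classical in
noncomputable def bis (n : ℕ) : Finset (Fin n → Bool) :=
  univ.filter fun σ => IsBisection (univ.filter fun i => σ i = true)

theorem mem_bis {n : ℕ} (σ : Fin n → Bool) :
    σ ∈ bis n ↔ IsBisection (univ.filter fun i => σ i = true) := by
  simp [bis]

theorem sum_spin {n : ℕ} (σ : Fin n → Bool) :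
    ∑ i, spin (σ i) = 2 * ((univ.filter fun i => σ i = true).card : ℝ) - n := by
  have h : ∀ i, spin (σ i) = 2 * (if σ i = true then 1 else 0) - 1 := by
    intro i; cases σ i <;> simp [spin]; norm_num
  simp only [h, Finset.sum_sub_distrib, ← Finset.mul_sum]
  simp

/-- every configuration is close to a bisection -/
theorem near_bis {n : ℕ} (ρ : Fin n → Bool) : ∃ ρ' ∈ bis n,
    ((univ.filter fun i => ρ i ≠ ρ' i).card : ℝ) ≤ |∑ i, spin (ρ i)| := by
  classical
  set S := univ.filter fun i => ρ i = true with hS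
  have hcard : S.card ≤ n := by simpa using Finset.card_le_univ S
  have key : ∃ S' : Finset (Fin n), S'.card = n / 2 ∧ ((S \ S').card + (S' \ S).card : ℤ) ≤ |2 * (S.card : ℤ) - n| := by
    rcases le_total (n / 2) S.card with h | h
    · obtain ⟨S', h1, h2⟩ := Finset.exists_subset_card_eq h
      refine ⟨S', h2, ?_⟩
      rw [Finset.sdiff_eq_empty_iff_subset.2 h1]
      have := Finset.card_sdiff_add_card_eq_card h1
      simp only [card_empty]
      rcases abs_cases (2 * (S.card : ℤ) - n) with h | h <;> omega
    · obtain ⟨S', h1, h2⟩ := Finset.exists_superset_card_eq h (by simp; omega)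
      refine ⟨S', h2, ?_⟩
      rw [Finset.sdiff_eq_empty_iff_subset.2 h1]
      have := Finset.card_sdiff_add_card_eq_card h1
      simp only [card_empty]
      rcases abs_cases (2 * (S.card : ℤ) - n) with h | h <;> omega
  obtain ⟨S', h1, h2⟩ := key
  refine ⟨fun i => decide (i ∈ S'), ?_, ?_⟩
  · have e : (univ.filter fun i => decide (i ∈ S') = true) = S' := by ext; simp
    rw [mem_bis, e]
    unfold IsBisection
    omega
  · rw [sum_spin, ← hS]
    have e : (univ.filter fun i => ρ i ≠ decide (i ∈ S')) = (S \ S') ∪ (S' \ S) := by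
      ext i
      simp only [hS, mem_filter, mem_univ, true_and, mem_union, Finset.mem_sdiff]
      rcases Bool.eq_false_or_eq_true (ρ i) with h | h <;> simp [h]
    have h3 : ((univ.filter fun i => ρ i ≠ decide (i ∈ S')).card : ℤ) ≤ |2 * (S.card : ℤ) - n| := by
      rw [e]
      refine le_trans ?_ h2
      exact_mod_cast Finset.card_union_le _ _
    exact_mod_cast h3

theorem bis_nonempty (n : ℕ) : (bis n).Nonempty := by
  obtain ⟨ρ, h, _⟩ := near_bis (n := n) (fun _ => true)
  exact ⟨ρ, h⟩

theorem bis_sum {n : ℕ} (σ : Fin n → Bool) (h : σ ∈ bis n) : |∑ e, se σ e| ≤ n / 2 := by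
  rw [sum_se, sum_spin]
  rw [mem_bis] at h
  obtain ⟨h1, h2⟩ := h
  set a := (univ.filter fun i => σ i = true).card with ha
  have h1' : (n:ℝ) - 1 ≤ 2 * a := by exact_mod_cast h1
  have h2' : 2 * (a:ℝ) ≤ n + 1 := by exact_mod_cast h2
  rcases Nat.eq_zero_or_pos n with hn | hn
  · subst hn
    have : a = 0 := by rw [ha]; simp
    simp [this]
  · have : (1:ℝ) ≤ n := by exact_mod_cast hn
    have : (2 * (a:ℝ) - n) ^ 2 ≤ 1 := by
      rw [sq_le_one_iff_abs_le_one, abs_le]; constructor <;> linarith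
    rw [abs_le]; constructor <;> nlinarith [sq_nonneg (2 * (a:ℝ) - n)]

theorem log_card_le {n : ℕ} (W : Finset (Fin n → Bool)) : Real.log W.card ≤ n * Real.log 2 := by
  rcases Nat.eq_zero_or_pos W.card with h | h
  · rw [h]; simp; positivity
  · have : W.card ≤ 2 ^ n := by simpa using Finset.card_le_univ W
    rw [← Real.log_pow]
    apply Real.log_le_log (by exact_mod_cast h)
    exact_mod_cast this


/-- centred Gaussian of standard deviation `|c|` -/
noncomputable def gk (c : ℝ) : Measure ℝ := ProbabilityTheory.gaussianReal 0 (NNReal.mk (c ^ 2) (sq_nonneg c))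

instance (c : ℝ) : IsProbabilityMeasure (gk c) := by unfold gk; infer_instance

theorem gk_eq (c : ℝ) : gk c = (ProbabilityTheory.gaussianReal 0 1).map (fun t => c * t) := by
  have := ProbabilityTheory.gaussianReal_map_const_mul (μ := 0) (v := 1) c
  rw [this, gk]; simp

noncomputable def c3 : ℝ := ∫ t, |t| ^ 3 ∂(ProbabilityTheory.gaussianReal 0 1)

theorem gauss_int (k : ℕ) (hk : k ≠ 0) : Integrable (fun t : ℝ => |t| ^ k) (ProbabilityTheory.gaussianReal 0 1) := by
  have := (ProbabilityTheory.memLp_id_gaussianReal (μ := 0) (v := 1) (k : NNReal)).integrable_norm_pow (p := k) hk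
  simpa using this

theorem c3_nonneg : 0 ≤ c3 := integral_nonneg fun t => by positivity

theorem mom_gk (c : ℝ) : Mom (gk c) (c ^ 2) (|c| ^ 3 * c3) := by
  have hm : AEMeasurable (fun t : ℝ => c * t) (ProbabilityTheory.gaussianReal 0 1) := by fun_prop
  have i1 : Integrable (fun t : ℝ => t) (ProbabilityTheory.gaussianReal 0 1) :=
    (ProbabilityTheory.memLp_id_gaussianReal (μ := 0) (v := 1) 1).integrable (by simp)
  have i2 : Integrable (fun t : ℝ => t ^ 2) (ProbabilityTheory.gaussianReal 0 1) := by
    simpa using gauss_int 2 (by simp)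
  refine ⟨inferInstance, ?_, ?_, ?_, ?_, ?_, ?_⟩
  · rw [gk_eq, integrable_map_measure (by fun_prop) hm]
    exact i1.const_mul c
  · rw [gk_eq, integrable_map_measure (by fun_prop) hm]
    have := i2.const_mul (c ^ 2)
    refine this.congr (Eventually.of_forall fun t => ?_)
    simp; ring
  · rw [gk_eq, integrable_map_measure (by fun_prop) hm]
    have := (gauss_int 3 (by simp)).const_mul (|c| ^ 3)
    refine this.congr (Eventually.of_forall fun t => ?_)
    simp [abs_mul]; ring
  · exact ProbabilityTheory.integral_id_gaussianReal
  · have := ProbabilityTheory.variance_fun_id_gaussianReal (μ := 0) (v := NNReal.mk (c ^ 2) (sq_nonneg c))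
    rw [ProbabilityTheory.variance_eq_integral (by fun_prop)] at this
    simpa [gk] using this
  · rw [gk_eq, integral_map hm (by fun_prop), c3, ← integral_const_mul]
    apply le_of_eq
    congr 1
    ext t
    rw [abs_mul]; ring

theorem gk_exp (c l : ℝ) : Integrable (fun t => Real.exp (l * t)) (gk c) ∧
    ∫ t, Real.exp (l * t) ∂(gk c) = Real.exp (c ^ 2 * l ^ 2 / 2) := by
  refine ⟨ProbabilityTheory.integrable_exp_mul_gaussianReal l, ?_⟩
  have := congrFun (ProbabilityTheory.mgf_fun_id_gaussianReal (μ := 0) (v := NNReal.mk (c ^ 2) (sq_nonneg c))) l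
  simpa [ProbabilityTheory.mgf, gk] using this

theorem gk_exp_pi {ι : Type*} [Fintype ι] (c l : ℝ) (a : ι → ℝ) :
    Integrable (fun x : ι → ℝ => Real.exp (l * ∑ i, a i * x i)) (Measure.pi fun _ => gk c) ∧
    ∫ x, Real.exp (l * ∑ i, a i * x i) ∂(Measure.pi fun _ : ι => gk c)
      = Real.exp (c ^ 2 * l ^ 2 / 2 * ∑ i, a i ^ 2) := by
  have e : (fun x : ι → ℝ => Real.exp (l * ∑ i, a i * x i)) = fun x => ∏ i, Real.exp ((l * a i) * x i) := by
    ext x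
    rw [← Real.exp_sum, Finset.mul_sum]
    congr 1
    apply Finset.sum_congr rfl; intros; ring
  rw [e]
  constructor
  · exact Integrable.fintype_prod (f := fun i t => Real.exp ((l * a i) * t)) (fun i => (gk_exp c (l * a i)).1)
  · rw [integral_fintype_prod_eq_prod (fun i t => Real.exp ((l * a i) * t))]
    simp only [(gk_exp c _).2]
    rw [← Real.exp_sum, Finset.mul_sum]
    congr 1
    apply Finset.sum_congr rfl; intros; ring

theorem gauge_mp {ι : Type*} [Fintype ι] (c : ℝ) (a : ι → ℝ) (ha : ∀ i, a i = 1 ∨ a i = -1) :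
    MeasurePreserving (fun (x : ι → ℝ) i => a i * x i) (Measure.pi fun _ => gk c) (Measure.pi fun _ => gk c) := by
  refine measurePreserving_pi (fun _ => gk c) (fun _ => gk c) (f := fun i t => a i * t) fun i => ?_
  refine ⟨by fun_prop, ?_⟩
  have := ProbabilityTheory.gaussianReal_map_const_mul (μ := 0) (v := NNReal.mk (c ^ 2) (sq_nonneg c)) (a i)
  unfold gk
  rw [this]
  rcases ha i with h | h <;> simp [h]

def gx {n : ℕ} (σ τ : Fin n → Bool) : Fin n → Bool := fun i => xor (σ i) (τ i)

theorem gx_gx {n : ℕ} (σ τ : Fin n → Bool) : gx (gx σ τ) τ = σ := by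
  ext i; simp [gx]

theorem spin_xor (a b : Bool) : spin (xor a b) = - (spin a * spin b) := by
  cases a <;> cases b <;> simp [spin]

theorem se_gx {n : ℕ} (σ τ : Fin n → Bool) (e : Ed n) : se (gx σ τ) e = se σ e * se τ e := by
  simp only [se, gx, spin_xor]; ring

/-- Hamming distance -/
def hd {n : ℕ} (σ τ : Fin n → Bool) : ℕ := (univ.filter fun i => σ i ≠ τ i).card

theorem hd_gx {n : ℕ} (σ ρ τ : Fin n → Bool) : hd (gx σ τ) (gx ρ τ) = hd σ ρ := by
  unfold hd
  congr 1
  ext i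
  simp [gx]

theorem se_diff {n : ℕ} (σ τ : Fin n → Bool) :
    ∑ e, (se σ e - se τ e) ^ 2 ≤ 4 * (n * hd σ τ) := by
  have h := sum_pairs (n := n) (fun p => if σ p.1 ≠ τ p.1 then (1:ℝ) else 0)
  have h1 : ∑ p : Fin n × Fin n, (if σ p.1 ≠ τ p.1 then (1:ℝ) else 0) = n * hd σ τ := by
    rw [Fintype.sum_prod_type_right]
    simp only [Finset.sum_boole, hd, sum_const, card_univ, Fintype.card_fin, nsmul_eq_mul]
  have h2 : (0:ℝ) ≤ ∑ i : Fin n, if σ i ≠ τ i then (1:ℝ) else 0 :=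
    Finset.sum_nonneg fun i _ => by split_ifs <;> norm_num
  rw [h1] at h
  have h3 : ∑ e, (se σ e - se τ e) ^ 2 ≤ ∑ e : Ed n, 4 * ((if σ e.1.1 ≠ τ e.1.1 then (1:ℝ) else 0) +
      (if σ e.1.swap.1 ≠ τ e.1.swap.1 then (1:ℝ) else 0)) := by
    apply Finset.sum_le_sum
    intro e _
    simp only [se, Prod.fst_swap]
    have aux : ∀ a b c d : Bool, (spin a * spin b - spin c * spin d) ^ 2 ≤
        4 * ((if a ≠ c then (1:ℝ) else 0) + (if b ≠ d then (1:ℝ) else 0)) := by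
      intro a b c d
      cases a <;> cases b <;> cases c <;> cases d <;> simp [spin] <;> norm_num
    exact aux _ _ _ _
  rw [← Finset.mul_sum] at h3
  simp only at h h3
  linarith

theorem avg_mag (n : ℕ) : ∑ ρ : Fin n → Bool, |∑ i, spin (ρ i)| ≤ 2 ^ n * Real.sqrt n := by
  have h2 : ∑ ρ : Fin n → Bool, (∑ i, spin (ρ i)) ^ 2 = 2 ^ n * n := by
    simp only [sq, Finset.sum_mul_sum]
    rw [Finset.sum_comm]
    have : ∀ i : Fin n, ∑ ρ : Fin n → Bool, ∑ j, spin (ρ i) * spin (ρ j) = 2 ^ n := by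
      intro i
      rw [Finset.sum_comm, Finset.sum_eq_single i]
      · simp [spin_sq]
      · intro j _ hj
        have inv : ∑ ρ : Fin n → Bool, spin (ρ i) * spin (ρ j) = ∑ ρ : Fin n → Bool, -(spin (ρ i) * spin (ρ j)) := by
          apply Fintype.sum_equiv (Function.Involutive.toPerm (fun ρ : Fin n → Bool => Function.update ρ i (!ρ i)) (by
            intro ρ; simp))
          intro ρ
          show spin (ρ i) * spin (ρ j) = -(spin (Function.update ρ i (!ρ i) i) * spin (Function.update ρ i (!ρ i) j))
          rw [Function.update_self, Function.update_of_ne hj]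
          have aux : ∀ a : Bool, spin (!a) = - spin a := by intro a; cases a <;> simp [spin]
          rw [aux]; ring
        rw [Finset.sum_neg_distrib] at inv
        linarith
      · simp
    simp only [this]
    simp; ring
  rcases Nat.eq_zero_or_pos n with hn | hn
  · subst hn; simp
  have hs : 0 < Real.sqrt n := Real.sqrt_pos.2 (by exact_mod_cast hn)
  have hss : Real.sqrt n * Real.sqrt n = n := Real.mul_self_sqrt (by positivity)
  have h3 : ∀ ρ : Fin n → Bool, |∑ i, spin (ρ i)| ≤ ((∑ i, spin (ρ i)) ^ 2 / Real.sqrt n + Real.sqrt n) / 2 := by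
    intro ρ
    rw [← sq_abs (∑ i, spin (ρ i))]
    set a := |∑ i, spin (ρ i)|
    have : a ^ 2 / Real.sqrt n + Real.sqrt n - 2 * a = (a - Real.sqrt n) ^ 2 / Real.sqrt n := by
      field_simp; ring
    have : 0 ≤ (a - Real.sqrt n) ^ 2 / Real.sqrt n := by positivity
    linarith
  calc _ ≤ ∑ ρ : Fin n → Bool, ((∑ i, spin (ρ i)) ^ 2 / Real.sqrt n + Real.sqrt n) / 2 :=
        Finset.sum_le_sum fun ρ _ => h3 ρ
    _ = _ := by
      rw [← Finset.sum_div, Finset.sum_add_distrib, ← Finset.sum_div, h2]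
      simp
      field_simp
      rw [sq, hss]; ring

noncomputable def Tq {n : ℕ} (l : ℝ) (x : Ed n → ℝ) (σ σ' : Fin n → Bool) : ℝ :=
  Real.exp (l * ∑ e, (se σ e - se σ' e) * x e) * Real.exp (- (2 * l ^ 2 * hd σ σ'))

theorem Tq_pos {n : ℕ} (l : ℝ) (x : Ed n → ℝ) (σ σ' : Fin n → Bool) : 0 < Tq l x σ σ' := by
  unfold Tq; positivity

theorem Tq_int {n : ℕ} (hn : 0 < n) (l : ℝ) (σ σ' : Fin n → Bool) :
    Integrable (fun x => Tq l x σ σ') (Measure.pi fun _ => gk (Real.sqrt n)⁻¹) ∧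
    ∫ x, Tq l x σ σ' ∂(Measure.pi fun _ => gk (Real.sqrt n)⁻¹) ≤ 1 := by
  have hn' : (0:ℝ) < n := by exact_mod_cast hn
  have hc2 : (Real.sqrt n)⁻¹ ^ 2 = 1 / (n:ℝ) := by rw [inv_pow, Real.sq_sqrt hn'.le, one_div]
  have g := gk_exp_pi (Real.sqrt n)⁻¹ l (fun e => se σ e - se σ' e)
  refine ⟨g.1.mul_const _, ?_⟩
  unfold Tq
  rw [integral_mul_const, g.2, ← Real.exp_add, Real.exp_le_one_iff, hc2]
  have := mul_le_mul_of_nonneg_left (se_diff σ σ') (show 0 ≤ 1 / (n:ℝ) * l ^ 2 / 2 by positivity)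
  have e : 1 / (n:ℝ) * l ^ 2 / 2 * (4 * (n * hd σ σ')) = 2 * l ^ 2 * hd σ σ' := by
    field_simp; ring
  linarith

noncomputable def Sq {n : ℕ} (l : ℝ) (x : Ed n → ℝ) : ℝ :=
  ∑ σ : Fin n → Bool, ∑ σ' : Fin n → Bool, Tq l x σ σ'

theorem Tq_le_Sq {n : ℕ} (l : ℝ) (x : Ed n → ℝ) (σ σ' : Fin n → Bool) : Tq l x σ σ' ≤ Sq l x := by
  calc Tq l x σ σ' ≤ ∑ σ' : Fin n → Bool, Tq l x σ σ' :=
        Finset.single_le_sum (f := Tq l x σ) (fun q _ => (Tq_pos l x σ q).le) (Finset.mem_univ σ')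
    _ ≤ Sq l x := Finset.single_le_sum (f := fun σ => ∑ σ' : Fin n → Bool, Tq l x σ σ')
        (fun q _ => Finset.sum_nonneg fun r _ => (Tq_pos l x q r).le) (Finset.mem_univ σ)

theorem Sq_int {n : ℕ} (hn : 0 < n) (l : ℝ) :
    Integrable (fun x => Sq (n := n) l x) (Measure.pi fun _ => gk (Real.sqrt n)⁻¹) ∧
    ∫ x, Sq (n := n) l x ∂(Measure.pi fun _ => gk (Real.sqrt n)⁻¹) ≤ 4 ^ n := by
  have h1 : ∀ σ : Fin n → Bool, Integrable (fun x => ∑ σ' : Fin n → Bool, Tq l x σ σ')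
      (Measure.pi fun _ => gk (Real.sqrt n)⁻¹) :=
    fun σ => integrable_finsetSum _ fun σ' _ => (Tq_int hn l σ σ').1
  refine ⟨integrable_finsetSum _ fun σ _ => h1 σ, ?_⟩
  unfold Sq
  rw [integral_finsetSum _ fun σ _ => h1 σ]
  calc _ ≤ ∑ σ : Fin n → Bool, ∑ σ' : Fin n → Bool, (1:ℝ) := by
        refine Finset.sum_le_sum fun σ _ => ?_
        rw [integral_finsetSum _ fun σ' _ => (Tq_int hn l σ σ').1]
        exact Finset.sum_le_sum fun σ' _ => (Tq_int hn l σ σ').2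
    _ = 4 ^ n := by
        simp only [sum_const, card_univ, Fintype.card_fun, Fintype.card_bool, Fintype.card_fin, nsmul_eq_mul,
          Nat.cast_pow, Nat.cast_ofNat, mul_one]
        rw [← mul_pow]; norm_num

theorem exists_R {n : ℕ} (hn : 0 < n) (l : ℝ) (hl : 0 < l) : ∃ R : (Ed n → ℝ) → ℝ,
    Integrable R (Measure.pi fun _ => gk (Real.sqrt n)⁻¹) ∧
    ∫ x, R x ∂(Measure.pi fun _ => gk (Real.sqrt n)⁻¹) ≤ n * Real.log 4 / l ∧
    ∀ x (σ σ' : Fin n → Bool), ∑ e, se σ e * x e - ∑ e, se σ' e * x e ≤ 2 * l * hd σ σ' + R x := by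
  obtain ⟨Sint, Sle⟩ := Sq_int hn l
  have hz0 : (0:ℝ) < 4 ^ n := by positivity
  refine ⟨fun x => (Sq l x / 4 ^ n - 1 + n * Real.log 4) / l,
    (((Sint.div_const _).sub (integrable_const 1)).add (integrable_const _)).div_const l, ?_, ?_⟩
  · have i1 : Integrable (fun x => Sq (n := n) l x / 4 ^ n - 1) (Measure.pi fun _ => gk (Real.sqrt n)⁻¹) :=
      (Sint.div_const _).sub (integrable_const 1)
    rw [integral_div, integral_add i1 (integrable_const _),
      integral_sub (Sint.div_const _) (integrable_const 1), integral_div]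
    simp only [integral_const, probReal_univ, one_smul]
    have : (∫ x, Sq (n := n) l x ∂(Measure.pi fun _ => gk (Real.sqrt n)⁻¹)) / 4 ^ n ≤ 1 := by
      rw [div_le_one hz0]; exact Sle
    gcongr
    linarith
  · intro x σ σ'
    have h1 := Tq_le_Sq l x σ σ'
    have hSpos : 0 < Sq l x := (Tq_pos l x σ σ').trans_le h1
    unfold Tq at h1
    rw [← Real.exp_add] at h1
    have h2 := (Real.le_log_iff_exp_le hSpos).2 h1
    have h3 : Real.log (Sq l x / 4 ^ n) ≤ Sq l x / 4 ^ n - 1 := Real.log_le_sub_one_of_pos (by positivity)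
    rw [Real.log_div hSpos.ne' hz0.ne', Real.log_pow] at h3
    have h4 : ∑ e, (se σ e - se σ' e) * x e = ∑ e, se σ e * x e - ∑ e, se σ' e * x e := by
      rw [← Finset.sum_sub_distrib]; apply Finset.sum_congr rfl; intros; ring
    rw [h4] at h2
    rw [← sub_le_iff_le_add', le_div_iff₀ hl]
    linarith

theorem balance (n : ℕ) (hn : 0 < n) (l : ℝ) (hl : 0 < l) :
    ∫ x, mx univ univ_nonempty (se (n := n)) x ∂(Measure.pi fun _ => gk (Real.sqrt n)⁻¹) -
      ∫ x, mx (bis n) (bis_nonempty n) se x ∂(Measure.pi fun _ => gk (Real.sqrt n)⁻¹) ≤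
      2 * n * Real.log 2 / l + 2 * l * Real.sqrt n := by
  obtain ⟨R, IR, eR, path⟩ := exists_R hn l hl
  set c := (Real.sqrt n)⁻¹ with hc
  set P := Measure.pi fun _ : Ed n => gk c with hP
  have hgauge : ∀ (τ σ : Fin n → Bool) (x : Ed n → ℝ),
      ∑ e, se σ e * (se τ e * x e) = ∑ e, se (gx σ τ) e * x e := by
    intro τ σ x
    apply Finset.sum_congr rfl; intro e _; rw [se_gx]; ring
  have path2 : ∀ x, 2 ^ n * mx univ univ_nonempty (se (n := n)) x -
      ∑ τ : Fin n → Bool, mx (bis n) (bis_nonempty n) se (fun e => se τ e * x e)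
        ≤ 2 ^ n * (2 * l * Real.sqrt n + R x) := by
    intro x
    obtain ⟨σ, -, hσ⟩ := exists_mx univ univ_nonempty (se (n := n)) x
    have h1 : ∀ τ : Fin n → Bool, mx univ univ_nonempty (se (n := n)) x -
        mx (bis n) (bis_nonempty n) se (fun e => se τ e * x e) ≤ 2 * l * |∑ i, spin (gx σ τ i)| + R x := by
      intro τ
      obtain ⟨ρ, hρ, hd1⟩ := near_bis (gx σ τ)
      have h2 := le_mx (bis n) (bis_nonempty n) se (fun e => se τ e * x e) ρ hρ
      rw [hgauge] at h2
      have h3 := path x σ (gx ρ τ)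
      have h4 : hd σ (gx ρ τ) = hd (gx σ τ) ρ := by
        rw [← hd_gx _ _ τ, gx_gx]
      rw [h4] at h3
      have h5 : (hd (gx σ τ) ρ : ℝ) ≤ |∑ i, spin (gx σ τ i)| := hd1
      have := mul_le_mul_of_nonneg_left h5 (show 0 ≤ 2 * l by positivity)
      linarith
    have h6 := Finset.sum_le_sum (s := univ) fun τ _ => h1 τ
    rw [Finset.sum_sub_distrib, Finset.sum_add_distrib, ← Finset.mul_sum] at h6
    have h7 : ∑ τ : Fin n → Bool, |∑ i, spin (gx σ τ i)| = ∑ τ : Fin n → Bool, |∑ i, spin (τ i)| := by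
      apply Fintype.sum_equiv (Function.Involutive.toPerm (fun τ : Fin n → Bool => gx σ τ) (by
        intro τ; ext i; simp [gx]))
      intro τ; rfl
    rw [h7] at h6
    have h8 := mul_le_mul_of_nonneg_left (avg_mag n) (show 0 ≤ 2 * l by positivity)
    simp only [sum_const, card_univ, Fintype.card_fun, Fintype.card_bool, Fintype.card_fin, nsmul_eq_mul, Nat.cast_pow, Nat.cast_ofNat] at h6
    linarith
  have I1 := integrable_mx univ univ_nonempty (se (n := n)) se_cases _ _ _ (mom_gk c)
  have I2 := integrable_mx (bis n) (bis_nonempty n) (se (n := n)) se_cases _ _ _ (mom_gk c)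
  rw [← hP] at I1 I2
  have mp := fun τ : Fin n → Bool => gauge_mp c (se τ) (se_cases τ)
  rw [← hP] at mp
  have I3 : ∀ τ : Fin n → Bool, Integrable (fun x => mx (bis n) (bis_nonempty n) se (fun e => se τ e * x e)) P :=
    fun τ => (mp τ).integrable_comp_of_integrable I2
  have e3 : ∀ τ : Fin n → Bool, ∫ x, mx (bis n) (bis_nonempty n) se (fun e => se τ e * x e) ∂P
      = ∫ x, mx (bis n) (bis_nonempty n) se x ∂P := by
    intro τ
    have h := integral_map (mp τ).measurable.aemeasurable (f := mx (bis n) (bis_nonempty n) se)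
      (by rw [(mp τ).map_eq]; exact I2.aestronglyMeasurable)
    rw [(mp τ).map_eq] at h
    exact h.symm
  have fin := integral_mono ((I1.const_mul (2 ^ n)).sub (integrable_finsetSum univ fun τ _ => I3 τ))
    (((integrable_const (2 * l * Real.sqrt n)).add IR).const_mul (2 ^ n)) path2
  simp only [Pi.sub_apply, Pi.add_apply] at fin
  rw [integral_sub (I1.const_mul (2 ^ n)) (integrable_finsetSum univ fun τ _ => I3 τ),
    integral_const_mul, integral_finsetSum _ (fun τ _ => I3 τ), integral_const_mul,
    integral_add (integrable_const _) IR] at fin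
  simp only [e3, sum_const, card_univ, Fintype.card_fun, Fintype.card_bool, Fintype.card_fin, nsmul_eq_mul,
    Nat.cast_pow, Nat.cast_ofNat, integral_const, probReal_univ, one_smul] at fin
  rw [← mul_sub] at fin
  have fin2 := le_of_mul_le_mul_left fin (by positivity)
  have l4 : Real.log 4 = 2 * Real.log 2 := by
    rw [show (4:ℝ) = 2 ^ 2 by norm_num, Real.log_pow]; norm_num
  rw [l4] at eR
  calc _ ≤ _ := fin2
    _ ≤ 2 * l * Real.sqrt n + n * (2 * Real.log 2) / l := by linarith
    _ = _ := by ring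


theorem mp_precomp {ι κ : Type*} [Fintype ι] [Fintype κ] (f : κ → ι) (hf : Function.Injective f)
    (μ : Measure ℝ) [IsProbabilityMeasure μ] :
    MeasurePreserving (fun x : ι → ℝ => fun k => x (f k)) (Measure.pi fun _ : ι => μ) (Measure.pi fun _ : κ => μ) := by
  refine ⟨by fun_prop, ?_⟩
  have h := ProbabilityTheory.iIndepFun_pi (μ := fun _ : ι => μ) (X := fun _ => (id : ℝ → ℝ)) (fun i => aemeasurable_id)
  have h2 := (h.precomp hf).map_fun_eq_pi_map (fun i => (measurable_pi_apply (f i)).aemeasurable)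
  refine h2.trans ?_
  congr 1
  ext1 k
  exact (measurePreserving_eval (fun _ : ι => μ) (f k)).map_eq

theorem mp_Y (n : ℕ) (hn : 0 < n) :
    MeasurePreserving (fun J : Fin n × Fin n → ℝ => fun e : Ed n => (Real.sqrt (2 * n))⁻¹ * (J e.1 + J e.1.swap))
      (skMeasure n) (Measure.pi fun _ : Ed n => gk (Real.sqrt n)⁻¹) := by
  set g := ProbabilityTheory.gaussianReal 0 1 with hg
  let f : Ed n ⊕ Ed n → Fin n × Fin n := Sum.elim (fun e => e.1) (fun e => e.1.swap)
  have hf : Function.Injective f := by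
    rintro (⟨⟨a, b⟩, h⟩ | ⟨⟨a, b⟩, h⟩) (⟨⟨c, d⟩, h'⟩ | ⟨⟨c, d⟩, h'⟩) hh <;> simp [f] at hh h h' ⊢ <;> omega
  have m1 := mp_precomp f hf g
  have m2 := measurePreserving_sumPiEquivProdPi (X := fun _ : Ed n ⊕ Ed n => ℝ) (fun _ => g)
  have m3 := (measurePreserving_arrowProdEquivProdArrow ℝ ℝ (Ed n) (fun _ => g) (fun _ => g)).symm
  let c := (Real.sqrt (2 * n))⁻¹
  have key : (g.prod g).map (fun z : ℝ × ℝ => c * (z.1 + z.2)) = gk (Real.sqrt n)⁻¹ := by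
    have : (fun z : ℝ × ℝ => c * (z.1 + z.2)) = (fun t => c * t) ∘ (fun z : ℝ × ℝ => z.1 + z.2) := rfl
    rw [this, ← Measure.map_map (by fun_prop) (by fun_prop)]
    have := ProbabilityTheory.gaussianReal_conv_gaussianReal (m₁ := 0) (m₂ := 0) (v₁ := 1) (v₂ := 1)
    rw [Measure.conv] at this
    rw [hg, this, ProbabilityTheory.gaussianReal_map_const_mul]
    unfold gk
    have hn' : (0:ℝ) < n := by exact_mod_cast hn
    congr 1
    · simp
    · apply NNReal.eq
      simp [c, NNReal.coe_mul]
      rw [mul_pow, inv_pow, inv_pow, Real.sq_sqrt hn'.le, Real.sq_sqrt (by norm_num)]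
      ring
  have m4 : MeasurePreserving (fun x : Ed n → ℝ × ℝ => fun e => c * ((x e).1 + (x e).2))
      (Measure.pi fun _ => g.prod g) (Measure.pi fun _ : Ed n => gk (Real.sqrt n)⁻¹) := by
    refine ⟨by fun_prop, ?_⟩
    have : IsProbabilityMeasure ((g.prod g).map (fun z : ℝ × ℝ => c * (z.1 + z.2))) :=
      Measure.isProbabilityMeasure_map (by fun_prop)
    have hk := Measure.pi_map_pi (μ := fun _ : Ed n => g.prod g) (f := fun _ (z : ℝ × ℝ) => c * (z.1 + z.2))
      (fun i => by fun_prop)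
    rw [hk, key]
  exact m4.comp (m3.comp (m2.comp m1))

theorem SK_eq (n : ℕ) (hn : 0 < n) :
    ∫ J, (⨆ σ : Fin n → Bool, -HSK n J σ) ∂(skMeasure n) =
      ∫ x, mx univ univ_nonempty se x ∂(Measure.pi fun _ : Ed n => gk (Real.sqrt n)⁻¹) := by
  have mp := mp_Y n hn
  set Y := (fun J : Fin n × Fin n → ℝ => fun e : Ed n => (Real.sqrt (2 * n))⁻¹ * (J e.1 + J e.1.swap)) with hY
  have h0 : ∀ J, (⨆ σ : Fin n → Bool, -HSK n J σ) = mx univ univ_nonempty se (Y J) +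
      (Real.sqrt (2 * n))⁻¹ * ∑ i, J (i, i) := by
    intro J
    have h1 : ∀ σ : Fin n → Bool, -HSK n J σ = ∑ e, se σ e * Y J e + (Real.sqrt (2 * n))⁻¹ * ∑ i, J (i, i) := by
      intro σ
      unfold HSK
      rw [sum_pairs]
      simp only [Prod.fst_swap, Prod.snd_swap, mul_assoc, spin_sq, mul_one, hY, neg_mul, neg_neg]
      rw [mul_add, Finset.mul_sum]
      congr 1
      apply Finset.sum_congr rfl
      intro e _
      unfold se
      ring
    simp_rw [h1]
    rw [← Finset.sup'_univ_eq_ciSup]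
    apply le_antisymm
    · apply Finset.sup'_le
      intro σ _
      have := le_mx univ univ_nonempty se (Y J) σ (mem_univ _)
      linarith
    · obtain ⟨σ, _, h⟩ := exists_mx univ univ_nonempty (se (n := n)) (Y J)
      rw [h]
      exact Finset.le_sup' (fun σ => ∑ e, se σ e * Y J e + (Real.sqrt (2 * n))⁻¹ * ∑ i, J (i, i)) (mem_univ σ)
  simp_rw [h0]
  have hmo := mom_gk (Real.sqrt n)⁻¹
  have hi := integrable_mx univ univ_nonempty (se (n := n)) se_cases (gk (Real.sqrt n)⁻¹) _ _ hmo
  have : ∀ i : Fin n × Fin n, IsProbabilityMeasure ((fun _ => ProbabilityTheory.gaussianReal 0 1 : Fin n × Fin n → Measure ℝ) i) := fun i => by infer_instance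
  have hg1 : Integrable (fun t : ℝ => t) (ProbabilityTheory.gaussianReal 0 1) := by
    exact (ProbabilityTheory.memLp_id_gaussianReal (μ := 0) (v := 1) 1).integrable (by simp)
  have hJ : ∀ p, Integrable (fun J : Fin n × Fin n → ℝ => J p) (skMeasure n) := fun p =>
    (measurePreserving_eval (fun _ : Fin n × Fin n => ProbabilityTheory.gaussianReal 0 1) p).integrable_comp_of_integrable hg1
  have hJ0 : ∀ p, ∫ J : Fin n × Fin n → ℝ, J p ∂(skMeasure n) = 0 := fun p => by
    have := integral_map (μ := skMeasure n) (φ := fun J => J p) (measurable_pi_apply p).aemeasurable (f := fun t : ℝ => t) (by fun_prop)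
    rw [← this]
    unfold skMeasure
    rw [(measurePreserving_eval (fun _ : Fin n × Fin n => ProbabilityTheory.gaussianReal 0 1) p).map_eq]
    exact ProbabilityTheory.integral_id_gaussianReal
  have hiY : Integrable (fun J => mx univ univ_nonempty se (Y J)) (skMeasure n) :=
    mp.integrable_comp_of_integrable hi
  rw [integral_add hiY ((integrable_finsetSum _ fun i _ => hJ (i, i)).const_mul _), integral_const_mul,
    integral_finsetSum _ (fun i _ => hJ (i, i))]
  simp only [hJ0, Finset.sum_const_zero, mul_zero, add_zero]
  rw [← mp.map_eq, integral_map (by exact mp.aemeasurable) (mx_cont _ _ _).aestronglyMeasurable]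


/-- Bernoulli expectation over subsets of s -/
noncomputable def Bexp {α : Type*} (p : ℝ) (s : Finset α) (f : Finset α → ℝ) : ℝ :=
  ∑ A ∈ s.powerset, p ^ A.card * (1 - p) ^ (s.card - A.card) * f A

section
variable {α : Type*} [DecidableEq α]

theorem Bexp_insert (p : ℝ) (s : Finset α) (a : α) (ha : a ∉ s) (f : Finset α → ℝ) :
    Bexp p (insert a s) f = (1 - p) * Bexp p s f + p * Bexp p s (fun A => f (insert a A)) := by
  unfold Bexp
  rw [Finset.sum_powerset_insert ha, Finset.mul_sum, Finset.mul_sum]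
  congr 1
  · apply Finset.sum_congr rfl
    intro A hA
    have := Finset.card_le_card (mem_powerset.1 hA)
    rw [Finset.card_insert_of_notMem ha, Nat.sub_add_comm this, pow_succ]
    ring
  · apply Finset.sum_congr rfl
    intro A hA
    have haA : a ∉ A := fun h => ha (mem_powerset.1 hA h)
    rw [Finset.card_insert_of_notMem ha, Finset.card_insert_of_notMem haA, Nat.add_sub_add_right, pow_succ]
    ring

theorem Bexp_const (p : ℝ) (s : Finset α) (c : ℝ) : Bexp p s (fun _ => c) = c := by
  unfold Bexp
  rw [← Finset.sum_mul, Finset.sum_pow_mul_eq_add_pow]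
  simp

theorem Bexp_add (p : ℝ) (s : Finset α) (f g : Finset α → ℝ) :
    Bexp p s (fun A => f A + g A) = Bexp p s f + Bexp p s g := by
  unfold Bexp
  rw [← Finset.sum_add_distrib]
  exact Finset.sum_congr rfl fun A _ => by ring

theorem Bexp_smul (p : ℝ) (s : Finset α) (c : ℝ) (f : Finset α → ℝ) :
    Bexp p s (fun A => c * f A) = c * Bexp p s f := by
  unfold Bexp
  rw [Finset.mul_sum]
  exact Finset.sum_congr rfl fun A _ => by ring

theorem Bexp_mono (p : ℝ) (hp : 0 ≤ p) (hp1 : p ≤ 1) (s : Finset α) (f g : Finset α → ℝ) (h : ∀ A, f A ≤ g A) :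
    Bexp p s f ≤ Bexp p s g := by
  unfold Bexp
  apply Finset.sum_le_sum
  intro A _
  have : 0 ≤ 1 - p := by linarith
  exact mul_le_mul_of_nonneg_left (h A) (by positivity)

theorem Bexp_card (p : ℝ) (s : Finset α) : Bexp p s (fun A => (A.card : ℝ)) = s.card * p := by
  induction s using Finset.induction_on with
  | empty => simp [Bexp]
  | insert a s ha ih =>
    rw [Bexp_insert _ _ _ ha, Finset.card_insert_of_notMem ha]
    have h : Bexp p s (fun A => ((insert a A).card : ℝ)) = Bexp p s (fun A => (A.card : ℝ) + 1) := by
      unfold Bexp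
      apply Finset.sum_congr rfl
      intro A hA
      have haA : a ∉ A := fun h => ha (mem_powerset.1 hA h)
      simp only [Finset.card_insert_of_notMem haA]; push_cast; rfl
    rw [h, Bexp_add, Bexp_const, ih]
    push_cast; ring

theorem Bexp_var (p : ℝ) (hp : 0 ≤ p) (hp1 : p ≤ 1) (s : Finset α) : ∀ (f : Finset α → ℝ)
    (_ : ∀ a A, |f (insert a A) - f A| ≤ 1),
    Bexp p s (fun A => f A ^ 2) - (Bexp p s f) ^ 2 ≤ s.card * (p * (1 - p)) := by
  induction s using Finset.induction_on with
  | empty => intro f hf; simp [Bexp]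
  | insert a s ha ih =>
    intro f hf
    rw [Bexp_insert _ _ _ ha, Bexp_insert _ _ _ ha, Finset.card_insert_of_notMem ha]
    have h0 := ih f hf
    have h1 := ih (fun A => f (insert a A)) (fun b A => by
      rw [Finset.insert_comm]; exact hf b _)
    have h2 : Bexp p s (fun A => f (insert a A)) ≤ Bexp p s f + 1 := by
      rw [← Bexp_const p s 1, ← Bexp_add]
      exact Bexp_mono p hp hp1 _ _ _ fun A => by linarith [(abs_le.1 (hf a A)).2]
    have h3 : Bexp p s f ≤ Bexp p s (fun A => f (insert a A)) + 1 := by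
      rw [← Bexp_const p s 1, ← Bexp_add]
      exact Bexp_mono p hp hp1 _ _ _ fun A => by linarith [(abs_le.1 (hf a A)).1]
    push_cast
    set m0 := Bexp p s f
    set m1 := Bexp p s (fun A => f (insert a A))
    set v0 := Bexp p s (fun A => f A ^ 2)
    set v1 := Bexp p s (fun A => f (insert a A) ^ 2)
    have h4 : (m0 - m1) ^ 2 ≤ 1 := by rw [sq_le_one_iff_abs_le_one, abs_le]; constructor <;> linarith
    have hq : 0 ≤ p * (1 - p) := mul_nonneg hp (by linarith)
    nlinarith [mul_le_mul_of_nonneg_left h0 (by linarith : 0 ≤ 1 - p), mul_le_mul_of_nonneg_left h1 hp,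
      mul_le_mul_of_nonneg_left h4 hq]

open Classical in
/-- Bernoulli probability of an event. -/
noncomputable def Bpr {α : Type*} (p : ℝ) (s : Finset α) (L : Finset α → Prop) : ℝ :=
  Bexp p s (fun A => if L A then 1 else 0)

theorem Bpr_mono (p : ℝ) (hp : 0 ≤ p) (hp1 : p ≤ 1) (s : Finset α) (L M : Finset α → Prop) (h : ∀ A, L A → M A) :
    Bpr p s L ≤ Bpr p s M := by
  unfold Bpr
  apply Bexp_mono p hp hp1
  intro A
  by_cases h1 : L A
  · simp [h1, h A h1]
  · simp only [h1, if_false]; split_ifs <;> norm_num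

theorem Bpr_cheb (p : ℝ) (hp : 0 ≤ p) (hp1 : p ≤ 1) (s : Finset α) (f : Finset α → ℝ)
    (hf : ∀ a A, |f (insert a A) - f A| ≤ 1) (t : ℝ) (ht : 0 < t) :
    Bpr p s (fun A => t ≤ |f A - Bexp p s f|) ≤ s.card * p / t ^ 2 := by
  rw [le_div_iff₀ (by positivity)]
  have hv := Bexp_var p hp hp1 s f hf
  set m := Bexp p s f with hm
  have h1 : Bexp p s (fun A => (f A - m) ^ 2) = Bexp p s (fun A => f A ^ 2) - m ^ 2 := by
    have : (fun A => (f A - m) ^ 2) = fun A => f A ^ 2 + ((-2 * m) * f A + m ^ 2) := by ext A; ring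
    rw [this, Bexp_add, Bexp_add, Bexp_smul, Bexp_const, ← hm]; ring
  have h2 : Bpr p s (fun A => t ≤ |f A - m|) * t ^ 2 ≤ Bexp p s (fun A => (f A - m) ^ 2) := by
    unfold Bpr
    rw [mul_comm, ← Bexp_smul]
    apply Bexp_mono p hp hp1
    intro A
    by_cases h : t ≤ |f A - m|
    · simp only [h, if_true, mul_one]
      rw [← sq_abs (f A - m)]
      gcongr
    · simp only [h, if_false, mul_zero]; positivity
  have h3 : (s.card : ℝ) * (p * (1 - p)) ≤ s.card * p := by
    have : (0:ℝ) ≤ s.card := by positivity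
    apply mul_le_mul_of_nonneg_left _ this
    nlinarith
  linarith

theorem Bpr_not (p : ℝ) (s : Finset α) (L : Finset α → Prop) :
    Bpr p s (fun A => ¬ L A) = 1 - Bpr p s L := by
  have h := Bexp_add p s (fun A => by classical exact if L A then (1:ℝ) else 0) (fun A => by classical exact if ¬ L A then (1:ℝ) else 0)
  have h2 := Bexp_const p s 1
  have : (fun A : Finset α => (by classical exact if L A then (1:ℝ) else 0) + (by classical exact if ¬ L A then (1:ℝ) else 0)) = fun _ => (1:ℝ) := by
    ext A; by_cases h : L A <;> simp [h]
  rw [this, h2] at h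
  unfold Bpr
  rw [eq_sub_iff_add_eq, add_comm]
  convert h.symm

open Classical in
/-- fraction of r-sets in L -/
noncomputable def qf {α : Type*} [Fintype α] (L : Finset α → Prop) (r : ℕ) : ℝ :=
  (((univ : Finset α).powersetCard r).filter L).card / (Fintype.card α).choose r

variable [Fintype α]

theorem Bpr_eq_sum (p : ℝ) (L : Finset α → Prop) :
    Bpr p univ L = ∑ r ∈ range (Fintype.card α + 1),
      p ^ r * (1 - p) ^ (Fintype.card α - r) * ((Fintype.card α).choose r * qf L r) := by
  classical
  unfold Bpr Bexp
  rw [Finset.sum_powerset, Finset.card_univ]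
  apply Finset.sum_congr rfl
  intro r hr
  have hr' : r ≤ Fintype.card α := by simpa [Nat.lt_succ_iff] using hr
  have h0 : ((Fintype.card α).choose r : ℝ) ≠ 0 := by exact_mod_cast (Nat.choose_pos hr').ne'
  unfold qf
  rw [mul_div_cancel₀ _ h0]
  rw [Finset.sum_congr rfl (g := fun A => p ^ r * (1 - p) ^ (Fintype.card α - r) * (if L A then 1 else 0))
    (fun A hA => by rw [(Finset.mem_powersetCard.1 hA).2])]
  rw [← Finset.mul_sum, Finset.sum_boole]

theorem qf_step (L : Finset α → Prop) (hL : ∀ A B, A ⊆ B → L B → L A) (r : ℕ) :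
    qf L (r + 1) ≤ qf L r := by
  classical
  unfold qf
  have h := Finset.local_lubell_yamamoto_meshalkin_inequality_div (𝕜 := ℝ) (α := α) (r := r + 1) (by omega)
    (𝒜 := ((univ : Finset α).powersetCard (r+1)).filter L) (by
      intro A hA; simp at hA; simpa using hA.1)
  simp only [Nat.add_sub_cancel] at h
  refine h.trans ?_
  gcongr
  intro A hA
  rw [Finset.mem_shadow_iff] at hA
  obtain ⟨B, hB, a, ha, rfl⟩ := hA
  simp only [mem_filter, mem_powersetCard, subset_univ, true_and] at hB ⊢
  refine ⟨?_, hL _ _ (erase_subset _ _) hB.2⟩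
  rw [card_erase_of_mem ha, hB.1]; rfl

theorem qf_anti (L : Finset α → Prop) (hL : ∀ A B, A ⊆ B → L B → L A) : Antitone (qf L) :=
  antitone_nat_of_succ_le (qf_step L hL)

theorem qf_not (L : Finset α → Prop) (r : ℕ) (hr : r ≤ Fintype.card α) : qf (fun A => ¬ L A) r = 1 - qf L r := by
  classical
  have h0 : ((Fintype.card α).choose r : ℝ) ≠ 0 := by exact_mod_cast (Nat.choose_pos hr).ne'
  unfold qf
  have := Finset.card_filter_add_card_filter_not (s := (univ : Finset α).powersetCard r) L
  rw [Finset.card_powersetCard, Finset.card_univ] at this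
  rw [eq_sub_iff_add_eq, ← add_div, div_eq_one_iff_eq h0]
  rw [add_comm]
  norm_cast
  convert this

theorem qf_nonneg (L : Finset α → Prop) (r : ℕ) : 0 ≤ qf L r := by unfold qf; positivity

theorem qf_imp (L M : Finset α → Prop) (r : ℕ) (h : ∀ A, A.card = r → L A → M A) : qf L r ≤ qf M r := by
  classical
  unfold qf
  gcongr with A hA
  intro hl
  exact h A (Finset.mem_powersetCard.1 hA).2 hl

theorem qf_or (L M : Finset α → Prop) (r : ℕ) : qf (fun A => L A ∨ M A) r ≤ qf L r + qf M r := by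
  classical
  unfold qf
  rw [← add_div]
  gcongr
  have h : (((univ : Finset α).powersetCard r).filter fun A => L A ∨ M A) ⊆
      (((univ : Finset α).powersetCard r).filter L) ∪ (((univ : Finset α).powersetCard r).filter M) := by
    intro A hA
    simp only [mem_filter, mem_union] at hA ⊢
    tauto
  have h2 := (Finset.card_le_card h).trans (Finset.card_union_le _ _)
  norm_cast
  refine le_trans (le_of_eq ?_) h2
  congr

theorem qf_card (K : ℕ → Prop) [DecidablePred K] (r : ℕ) (hr : r ≤ Fintype.card α) :
    qf (α := α) (fun A => K A.card) r = if K r then 1 else 0 := by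
  classical
  have h0 : ((Fintype.card α).choose r : ℝ) ≠ 0 := by exact_mod_cast (Nat.choose_pos hr).ne'
  unfold qf
  by_cases h : K r
  · simp only [h, if_true]
    have : ((univ : Finset α).powersetCard r).filter (fun A => K A.card) = (univ : Finset α).powersetCard r := by
      apply Finset.filter_true_of_mem
      intro A hA; rwa [(Finset.mem_powersetCard.1 hA).2]
    have h2 : (((univ : Finset α).powersetCard r).filter (fun A => K A.card)).card = (Fintype.card α).choose r := by
      rw [this, Finset.card_powersetCard, Finset.card_univ]
    convert div_self h0
    convert h2
  · simp only [h, if_false]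
    have : ((univ : Finset α).powersetCard r).filter (fun A => K A.card) = ∅ := by
      apply Finset.filter_false_of_mem
      intro A hA; rwa [(Finset.mem_powersetCard.1 hA).2]
    have h2 : (((univ : Finset α).powersetCard r).filter (fun A => K A.card)).card = 0 := by
      rw [this, Finset.card_empty]
    rw [div_eq_zero_iff, Nat.cast_eq_zero]
    left
    convert h2

theorem transfer_lower (p : ℝ) (hp : 0 ≤ p) (hp1 : p ≤ 1) (L : Finset α → Prop)
    (hL : ∀ A B, A ⊆ B → L B → L A) (m : ℕ) :
    qf L m * Bpr p univ (fun A : Finset α => A.card ≤ m) ≤ Bpr p univ L := by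
  classical
  rw [Bpr_eq_sum, Bpr_eq_sum, Finset.mul_sum]
  apply Finset.sum_le_sum
  intro r hr
  have hr' : r ≤ Fintype.card α := by simpa [Nat.lt_succ_iff] using hr
  have hq : 0 ≤ 1 - p := by linarith
  rw [qf_card (fun k => k ≤ m) r hr']
  have : qf L m * (if r ≤ m then 1 else 0) ≤ qf L r := by
    split_ifs with h
    · simpa using qf_anti L hL h
    · simpa using qf_nonneg L r
  calc _ = p ^ r * (1 - p) ^ (Fintype.card α - r) * ((Fintype.card α).choose r * (qf L m * (if r ≤ m then 1 else 0))) := by ring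
    _ ≤ _ := by gcongr

theorem transfer_upper (p : ℝ) (hp : 0 ≤ p) (hp1 : p ≤ 1) (L : Finset α → Prop)
    (hL : ∀ A B, A ⊆ B → L A → L B) (m : ℕ) (hm : m ≤ Fintype.card α) :
    qf L m * Bpr p univ (fun A : Finset α => m ≤ A.card) ≤ Bpr p univ L := by
  classical
  rw [Bpr_eq_sum, Bpr_eq_sum, Finset.mul_sum]
  apply Finset.sum_le_sum
  intro r hr
  have hr' : r ≤ Fintype.card α := by simpa [Nat.lt_succ_iff] using hr
  have hq : 0 ≤ 1 - p := by linarith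
  rw [qf_card (fun k => m ≤ k) r hr']
  have : qf L m * (if m ≤ r then 1 else 0) ≤ qf L r := by
    split_ifs with h
    · have h1 := qf_anti (fun A => ¬ L A) (fun A B hAB hB hA => hB (hL A B hAB hA)) h
      rw [qf_not _ _ hr', qf_not _ _ hm] at h1
      linarith
    · simpa using qf_nonneg L r
  calc _ = p ^ r * (1 - p) ^ (Fintype.card α - r) * ((Fintype.card α).choose r * (qf L m * (if m ≤ r then 1 else 0))) := by ring
    _ ≤ _ := by gcongr

end


/-- Bernoulli measure on Bool -/
noncomputable def bm (p : ℝ) : Measure Bool :=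
  ENNReal.ofReal (1 - p) • Measure.dirac false + ENNReal.ofReal p • Measure.dirac true

theorem bm_prob (p : ℝ) (hp : 0 ≤ p) (hp1 : p ≤ 1) : IsProbabilityMeasure (bm p) := by
  constructor
  simp only [bm, Measure.add_apply, Measure.smul_apply, measure_univ, smul_eq_mul, mul_one]
  rw [← ENNReal.ofReal_add (by linarith) hp]; simp

theorem bm_real (p : ℝ) (hp : 0 ≤ p) (hp1 : p ≤ 1) (b : Bool) : (bm p).real {b} = if b then p else 1 - p := by
  unfold bm Measure.real
  cases b
  · simp [hp1]
  · simp [hp]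

theorem bm_integral (p : ℝ) (hp : 0 ≤ p) (hp1 : p ≤ 1) (g : Bool → ℝ) :
    ∫ b, g b ∂(bm p) = (1 - p) * g false + p * g true := by
  have := bm_prob p hp hp1
  rw [integral_fintype Integrable.of_finite]
  simp [bm_real p hp hp1]; ring

noncomputable def bphi (p s : ℝ) (b : Bool) : ℝ := ((if b then 1 else 0) - p) / s

theorem bern_mom (n : ℕ) (hn : 0 < n) (p s : ℝ) (hp : 0 ≤ p) (hp1 : p ≤ 1) (hs : 0 < s) (hsp : s ^ 2 = n * p * (1 - p)) :
    Mom ((bm p).map (bphi p s)) (((Real.sqrt n)⁻¹) ^ 2) (1 / (n * s)) := by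
  have := bm_prob p hp hp1
  have hn' : (0:ℝ) < n := by exact_mod_cast hn
  have hm : Measurable (bphi p s) := measurable_of_finite _
  have hI : ∀ g : ℝ → ℝ, Continuous g → Integrable g ((bm p).map (bphi p s)) := by
    intro g hg
    rw [integrable_map_measure hg.aestronglyMeasurable hm.aemeasurable]
    exact Integrable.of_finite
  have hE : ∀ g : ℝ → ℝ, Continuous g → ∫ t, g t ∂((bm p).map (bphi p s)) = (1 - p) * g (-p / s) + p * g ((1 - p) / s) := by
    intro g hg
    rw [integral_map hm.aemeasurable hg.aestronglyMeasurable, bm_integral p hp hp1]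
    simp [bphi]
  refine ⟨Measure.isProbabilityMeasure_map hm.aemeasurable, hI _ (by fun_prop), hI _ (by fun_prop), hI _ (by fun_prop), ?_, ?_, ?_⟩
  · rw [hE _ (by fun_prop)]; field_simp; ring
  · rw [hE _ (by fun_prop), inv_pow, Real.sq_sqrt hn'.le, div_pow, div_pow, hsp]
    have : p * (1 - p) ≠ 0 := by
      intro h
      have : s ^ 2 = 0 := by rw [hsp, mul_assoc, h, mul_zero]
      have := pow_pos hs 2
      linarith
    have h1 : p ≠ 0 := left_ne_zero_of_mul this
    have h2 : 1 - p ≠ 0 := right_ne_zero_of_mul this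
    field_simp
    ring
  · rw [hE _ (by fun_prop), abs_div, abs_div, abs_neg, abs_of_nonneg hp, abs_of_nonneg (by linarith : 0 ≤ 1 - p), abs_of_pos hs]
    have h1 : (1 - p) * (p / s) ^ 3 + p * ((1 - p) / s) ^ 3 = p * (1 - p) * (p ^ 2 + (1 - p) ^ 2) / s ^ 3 := by
      field_simp
    have h2 : 1 / (n * s) = p * (1 - p) / s ^ 3 := by
      rw [div_eq_div_iff (by positivity) (by positivity)]
      rw [pow_succ, hsp]; ring
    rw [h1, h2]
    have : 0 ≤ p * (1 - p) := mul_nonneg hp (by linarith)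
    apply div_le_div_of_nonneg_right _ (by positivity)
    nlinarith [mul_nonneg this this]

theorem bern_integral {α : Type*} [Fintype α] [DecidableEq α] (p s : ℝ) (hp : 0 ≤ p) (hp1 : p ≤ 1)
    (f : (α → ℝ) → ℝ) (hf : Continuous f) :
    ∫ x, f x ∂(Measure.pi fun _ : α => (bm p).map (bphi p s)) =
      Bexp p univ (fun A => f (fun e => ((if e ∈ A then 1 else 0) - p) / s)) := by
  have := bm_prob p hp hp1
  have hm : Measurable (bphi p s) := measurable_of_finite _
  have : IsProbabilityMeasure ((bm p).map (bphi p s)) := Measure.isProbabilityMeasure_map hm.aemeasurable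
  have h1 := Measure.pi_map_pi (μ := fun _ : α => bm p) (f := fun _ => bphi p s) (fun _ => hm.aemeasurable)
  rw [← h1, integral_map (measurable_of_finite _).aemeasurable hf.aestronglyMeasurable,
    integral_fintype Integrable.of_finite]
  unfold Bexp
  rw [Finset.powerset_univ]
  symm
  apply Finset.sum_nbij' (i := fun A => fun e => decide (e ∈ A)) (j := fun b => univ.filter fun e => b e = true)
  · simp
  · simp
  · intro A _; ext e; simp
  · intro b _; ext e; simp
  · intro A _
    have h2 : (Measure.pi fun _ : α => bm p).real {fun e => decide (e ∈ A)} = p ^ A.card * (1 - p) ^ ((univ : Finset α).card - A.card) := by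
      unfold Measure.real
      rw [Measure.pi_singleton, ENNReal.toReal_prod]
      have : ∀ e, ((bm p) {decide (e ∈ A)}).toReal = if e ∈ A then p else 1 - p := by
        intro e
        have := bm_real p hp hp1 (decide (e ∈ A))
        unfold Measure.real at this
        rw [this]; simp
      simp_rw [this]
      rw [Finset.prod_ite, Finset.prod_const, Finset.prod_const]
      congr 2
      · congr 1; ext e; simp
      · rw [Finset.card_univ, ← Finset.card_compl]; congr 1; ext e; simp
    rw [h2, smul_eq_mul]
    congr 1
    simp only [bphi, decide_eq_true_eq]


/-- graph with edge set A -/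
def gr {n : ℕ} (A : Finset (Ed n)) : SimpleGraph (Fin n) where
  Adj i j := (∃ h : i < j, (⟨(i, j), h⟩ : Ed n) ∈ A) ∨ (∃ h : j < i, (⟨(j, i), h⟩ : Ed n) ∈ A)
  symm := ⟨fun i j h => h.symm⟩
  loopless := ⟨fun i h => by rcases h with ⟨h, _⟩ | ⟨h, _⟩ <;> exact lt_irrefl _ h⟩

theorem gr_adj {n : ℕ} (A : Finset (Ed n)) (e : Ed n) : (gr A).Adj e.1.1 e.1.2 ↔ e ∈ A := by
  obtain ⟨⟨i, j⟩, h⟩ := e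
  simp only [gr]
  constructor
  · rintro (⟨_, h'⟩ | ⟨h', _⟩)
    · exact h'
    · exact absurd h' (not_lt.2 h.le)
  · intro h'; exact Or.inl ⟨h, h'⟩

theorem gr_inj {n : ℕ} : Function.Injective (gr (n := n)) := by
  intro A B h
  ext e
  rw [← gr_adj A, ← gr_adj B, h]

theorem gr_surj {n : ℕ} : Function.Surjective (gr (n := n)) := by
  classical
  intro G
  refine ⟨univ.filter fun e => G.Adj e.1.1 e.1.2, ?_⟩
  ext i j
  simp only [gr, mem_filter, mem_univ, true_and]
  constructor
  · rintro (⟨_, h⟩ | ⟨_, h⟩)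
    · exact h
    · exact h.symm
  · intro h
    rcases lt_or_gt_of_ne h.ne with h' | h'
    · exact Or.inl ⟨h', h⟩
    · exact Or.inr ⟨h', h.symm⟩

theorem gr_ncard {n : ℕ} (A : Finset (Ed n)) : (gr A).edgeSet.ncard = A.card := by
  have hinj : Function.Injective (fun e : Ed n => s(e.1.1, e.1.2)) := by
    rintro ⟨⟨a, b⟩, h⟩ ⟨⟨c, d⟩, h'⟩ hh
    simp only [Sym2.eq_iff] at hh h h'
    simp only [Subtype.mk.injEq, Prod.mk.injEq]
    omega
  have : (gr A).edgeSet = (fun e : Ed n => s(e.1.1, e.1.2)) '' (A : Set (Ed n)) := by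
    ext x
    induction x using Sym2.ind with
    | _ i j =>
      simp only [SimpleGraph.mem_edgeSet, Set.mem_image, mem_coe]
      constructor
      · rintro (⟨h, h'⟩ | ⟨h, h'⟩)
        · exact ⟨_, h', rfl⟩
        · exact ⟨_, h', Sym2.eq_swap⟩
      · rintro ⟨e, he, h⟩
        rw [← SimpleGraph.mem_edgeSet, ← h, SimpleGraph.mem_edgeSet, gr_adj]
        exact he
  rw [this, Set.ncard_image_of_injective _ hinj, Set.ncard_coe_finset]

theorem probUniform_eq {n : ℕ} (m : ℕ) (P : SimpleGraph (Fin n) → Prop) :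
    probUniform {G : SimpleGraph (Fin n) | G.edgeSet.ncard = m} {G | P G} = qf (fun A : Finset (Ed n) => P (gr A)) m := by
  classical
  have h1 : {G : SimpleGraph (Fin n) | G.edgeSet.ncard = m} = gr '' (((univ : Finset (Ed n)).powersetCard m : Finset (Finset (Ed n))) : Set (Finset (Ed n))) := by
    ext G
    obtain ⟨A, rfl⟩ := gr_surj G
    simp [gr_ncard, gr_inj.eq_iff, mem_powersetCard]
  have h2 : {G : SimpleGraph (Fin n) | G.edgeSet.ncard = m} ∩ {G | P G} =
      gr '' ((((univ : Finset (Ed n)).powersetCard m).filter fun A => P (gr A) : Finset (Finset (Ed n))) : Set (Finset (Ed n))) := by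
    ext G
    obtain ⟨A, rfl⟩ := gr_surj G
    simp [gr_ncard, gr_inj.eq_iff, mem_powersetCard]
  unfold probUniform qf
  rw [h2, h1, Set.ncard_image_of_injective _ gr_inj, Set.ncard_image_of_injective _ gr_inj,
    Set.ncard_coe_finset, Set.ncard_coe_finset, card_powersetCard, card_univ]

/-- cut of spin configuration -/
noncomputable def ct {n : ℕ} (A : Finset (Ed n)) (σ : Fin n → Bool) : ℝ := ∑ e ∈ A, (1 - se σ e) / 2

theorem cut_eq {n : ℕ} (A : Finset (Ed n)) (σ : Fin n → Bool) :
    (cutSize (gr A) (univ.filter fun i => σ i = true) : ℝ) = ct A σ := by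
  classical
  have h1 : (cutSize (gr A) (univ.filter fun i => σ i = true) : ℝ) =
      ∑ p : Fin n × Fin n, (if σ p.1 = true ∧ σ p.2 = false ∧ (gr A).Adj p.1 p.2 then 1 else 0) := by
    unfold cutSize
    push_cast
    rw [Finset.sum_filter, Fintype.sum_prod_type]
    apply Finset.sum_congr rfl
    intro i _
    rw [Finset.compl_filter, Finset.sum_filter]
    by_cases hi : σ i = true
    · simp only [hi, if_true, true_and]
      apply Finset.sum_congr rfl
      intro j _
      by_cases hj : σ j = true <;> simp [hj]
    · simp [hi]
  rw [h1, sum_pairs]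
  have h2 : ∑ i : Fin n, (if σ (i, i).1 = true ∧ σ (i, i).2 = false ∧ (gr A).Adj (i, i).1 (i, i).2 then (1:ℝ) else 0) = 0 := by
    apply Finset.sum_eq_zero
    intro i _
    simp
  rw [h2, add_zero]
  unfold ct
  rw [← Finset.sum_subset (Finset.subset_univ A)]
  · apply Finset.sum_congr rfl
    intro e he
    have ha := (gr_adj A e).2 he
    simp only [Prod.fst_swap, Prod.snd_swap, ha, ha.symm, and_true, se]
    cases σ e.1.1 <;> cases σ e.1.2 <;> simp [spin]
  · intro e _ he
    have ha : ¬ (gr A).Adj e.1.1 e.1.2 := fun h => he ((gr_adj A e).1 h)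
    have ha' : ¬ (gr A).Adj e.1.2 e.1.1 := fun h => ha h.symm
    simp [ha, ha']

/-- real valued min cut -/
noncomputable def Mc {n : ℕ} (A : Finset (Ed n)) : ℝ := mcut (gr A)

theorem Mc_le {n : ℕ} (A : Finset (Ed n)) (σ : Fin n → Bool) (h : σ ∈ bis n) : Mc A ≤ ct A σ := by
  rw [← cut_eq]
  unfold Mc mcut
  rw [Nat.cast_le]
  exact Nat.sInf_le ⟨_, (mem_bis σ).1 h, rfl⟩

theorem Mc_exists {n : ℕ} (A : Finset (Ed n)) : ∃ σ ∈ bis n, Mc A = ct A σ := by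
  obtain ⟨τ, hτ⟩ := bis_nonempty n
  have hne : {k : ℕ | ∃ S : Finset (Fin n), IsBisection S ∧ cutSize (gr A) S = k}.Nonempty :=
    ⟨_, _, (mem_bis τ).1 hτ, rfl⟩
  obtain ⟨S, hS, hk⟩ := Nat.sInf_mem hne
  have hS' : (univ.filter fun i => decide (i ∈ S) = true) = S := by ext; simp
  refine ⟨fun i => decide (i ∈ S), ?_, ?_⟩
  · rw [mem_bis, hS']; exact hS
  · rw [← cut_eq, hS', hk]; rfl

theorem ct_term {n : ℕ} (σ : Fin n → Bool) (e : Ed n) : 0 ≤ (1 - se σ e) / 2 ∧ (1 - se σ e) / 2 ≤ 1 := by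
  rcases se_cases σ e with h | h <;> rw [h] <;> norm_num

theorem Mc_mono {n : ℕ} (A B : Finset (Ed n)) (h : A ⊆ B) : Mc A ≤ Mc B := by
  obtain ⟨σ, hσ, h1⟩ := Mc_exists B
  rw [h1]
  refine (Mc_le A σ hσ).trans ?_
  exact Finset.sum_le_sum_of_subset_of_nonneg h fun e _ _ => (ct_term σ e).1

theorem Mc_lip {n : ℕ} (a : Ed n) (A : Finset (Ed n)) : |Mc (insert a A) - Mc A| ≤ 1 := by
  have h0 := Mc_mono A (insert a A) (subset_insert _ _)
  rw [abs_of_nonneg (by linarith)]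
  obtain ⟨σ, hσ, h1⟩ := Mc_exists A
  have h2 := Mc_le (insert a A) σ hσ
  have h3 : ct (insert a A) σ ≤ ct A σ + 1 := by
    by_cases ha : a ∈ A
    · rw [insert_eq_of_mem ha]; linarith
    · unfold ct
      rw [sum_insert ha]
      linarith [(ct_term σ a).2]
  linarith

theorem Mc_mx {n : ℕ} (A : Finset (Ed n)) (p s : ℝ) (hp : 0 ≤ p) (hs : 0 < s) :
    |Mc A - (A.card / 2 - s / 2 * mx (bis n) (bis_nonempty n) se (fun e => ((if e ∈ A then 1 else 0) - p) / s))| ≤ p * n / 4 := by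
  set x : Ed n → ℝ := fun e => ((if e ∈ A then 1 else 0) - p) / s with hx
  have key : ∀ σ, ct A σ = A.card / 2 - s / 2 * ∑ e, se σ e * x e - p / 2 * ∑ e, se σ e := by
    intro σ
    have h1 : ∑ e ∈ A, se σ e = ∑ e, se σ e * (if e ∈ A then 1 else 0) := by simp
    have h2 : s * ∑ e, se σ e * x e = ∑ e, se σ e * (if e ∈ A then 1 else 0) - p * ∑ e, se σ e := by
      rw [Finset.mul_sum, Finset.mul_sum, ← Finset.sum_sub_distrib]
      apply Finset.sum_congr rfl
      intro e _
      rw [hx]; field_simp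
    unfold ct
    rw [← Finset.sum_div, Finset.sum_sub_distrib, h1]
    simp only [sum_const, nsmul_eq_mul, mul_one]
    linarith
  have hb : ∀ σ ∈ bis n, |p / 2 * ∑ e, se σ e| ≤ p * n / 4 := by
    intro σ hσ
    rw [abs_mul, abs_of_nonneg (by linarith : 0 ≤ p / 2)]
    have := mul_le_mul_of_nonneg_left (bis_sum σ hσ) (by linarith : 0 ≤ p / 2)
    linarith
  rw [abs_le]
  constructor
  · obtain ⟨σ, hσ, h⟩ := Mc_exists A
    have h1 := le_mx (bis n) (bis_nonempty n) se x σ hσ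
    have h2 := mul_le_mul_of_nonneg_left h1 (by linarith : 0 ≤ s / 2)
    rw [h, key]
    linarith [(abs_le.1 (hb σ hσ)).2]
  · obtain ⟨σ, hσ, h⟩ := exists_mx (bis n) (bis_nonempty n) se x
    have h1 := Mc_le A σ hσ
    rw [key] at h1
    rw [h]
    linarith [(abs_le.1 (hb σ hσ)).1]


/-- normalised SK ground state -/
noncomputable def an (n : ℕ) : ℝ :=
  (n : ℝ)⁻¹ * ∫ x, mx univ univ_nonempty se x ∂(Measure.pi fun _ : Ed n => gk (Real.sqrt n)⁻¹)

theorem log2_le : Real.log 2 ≤ 1 := by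
  have := Real.log_le_sub_one_of_pos (show (0:ℝ) < 2 by norm_num)
  linarith

theorem finite_n (n : ℕ) (hn : 0 < n) (γ : ℝ) (hγ : 0 < γ) (h4 : 4 * γ ≤ n) (β l : ℝ) (hβ : 0 < β) (hl : 0 < l) :
    ∃ c : ℝ, |Bexp (2 * γ / n) univ (Mc (n := n)) / n - (γ / 2 - Real.sqrt (2 * γ * (1 - 2 * γ / n)) / 2 * c)| ≤ γ / n ∧
      |c - an n| ≤ 2 / l + 2 * l / Real.sqrt n + 1 / β + β ^ 2 / Real.sqrt γ + β ^ 2 * c3 / Real.sqrt n := by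
  have hn' : (0:ℝ) < n := by exact_mod_cast hn
  set p := 2 * γ / n with hp
  have hp0 : 0 ≤ p := by positivity
  have hp2 : p ≤ 1 / 2 := by rw [hp, div_le_iff₀ hn']; linarith
  set s := Real.sqrt (2 * γ * (1 - 2 * γ / n)) with hs
  have hs2 : s ^ 2 = 2 * γ * (1 - p) := Real.sq_sqrt (mul_nonneg (by linarith) (by rw [← hp]; linarith))
  have hsg : Real.sqrt γ ≤ s := by
    apply Real.sqrt_le_sqrt
    nlinarith
  have hg0 : 0 < Real.sqrt γ := Real.sqrt_pos.2 hγ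
  have hs0 : 0 < s := lt_of_lt_of_le hg0 hsg
  have hsp : s ^ 2 = n * p * (1 - p) := by rw [hs2, hp]; field_simp
  have mb := bern_mom n hn p s hp0 (by linarith) hs0 hsp
  have mg := mom_gk (Real.sqrt n)⁻¹
  have hsn : 0 < Real.sqrt n := Real.sqrt_pos.2 hn'
  have hsn2 : Real.sqrt n ^ 2 = n := Real.sq_sqrt hn'.le
  have hu := universality (bis n) (bis_nonempty n) (se (n := n)) se_cases β hβ _ _ _ _ _ mb mg
  have hlog := log_card_le (bis n)
  have hbal := balance n hn l hl
  have hbi := bern_integral p s hp0 (by linarith) (mx (bis n) (bis_nonempty n) (se (n := n))) (mx_cont _ _ _)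
  have hle : ∫ x, mx (bis n) (bis_nonempty n) se x ∂(Measure.pi fun _ : Ed n => gk (Real.sqrt n)⁻¹) ≤
      ∫ x, mx univ univ_nonempty se x ∂(Measure.pi fun _ : Ed n => gk (Real.sqrt n)⁻¹) := by
    apply integral_mono (integrable_mx _ _ _ se_cases _ _ _ mg) (integrable_mx _ _ _ se_cases _ _ _ mg)
    intro x
    obtain ⟨σ, _, h⟩ := exists_mx (bis n) (bis_nonempty n) se x
    show mx (bis n) (bis_nonempty n) se x ≤ _
    rw [h]
    exact le_mx univ univ_nonempty se x σ (mem_univ _)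
  set IK := ∫ x, mx (bis n) (bis_nonempty n) se x ∂(Measure.pi fun _ : Ed n => (bm p).map (bphi p s)) with hIK
  set IB := ∫ x, mx (bis n) (bis_nonempty n) se x ∂(Measure.pi fun _ : Ed n => gk (Real.sqrt n)⁻¹) with hIB
  set IA := ∫ x, mx univ univ_nonempty se x ∂(Measure.pi fun _ : Ed n => gk (Real.sqrt n)⁻¹) with hIA
  have hE : |Bexp p univ (Mc (n := n)) - ((Fintype.card (Ed n) : ℝ) * p / 2 - s / 2 * IK)| ≤ p * n / 4 := by
    have h1 : ((Fintype.card (Ed n) : ℝ) * p / 2 - s / 2 * IK) = Bexp p univ (fun A : Finset (Ed n) => A.card / 2 - s / 2 *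
        mx (bis n) (bis_nonempty n) se (fun e => ((if e ∈ A then 1 else 0) - p) / s)) := by
      rw [hbi, ← card_univ, ← Bexp_card]
      have : (fun A : Finset (Ed n) => (A.card:ℝ) / 2 - s / 2 *
        mx (bis n) (bis_nonempty n) se (fun e => ((if e ∈ A then 1 else 0) - p) / s)) =
        fun A : Finset (Ed n) => (1 / 2) * (A.card : ℝ) + (- (s / 2)) *
        mx (bis n) (bis_nonempty n) se (fun e => ((if e ∈ A then 1 else 0) - p) / s) := by ext A; ring
      rw [this, Bexp_add, Bexp_smul, Bexp_smul]; ring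
    rw [h1, abs_sub_le_iff]
    have hc := Bexp_const p (univ : Finset (Ed n)) (p * n / 4)
    constructor
    · rw [sub_le_iff_le_add, ← hc, ← Bexp_add]
      apply Bexp_mono p hp0 (by linarith)
      intro A
      linarith [(abs_le.1 (Mc_mx A p s hp0 hs0)).2]
    · rw [sub_le_iff_le_add, ← hc, ← Bexp_add]
      apply Bexp_mono p hp0 (by linarith)
      intro A
      linarith [(abs_le.1 (Mc_mx A p s hp0 hs0)).1]
  have hpn : p * n = 2 * γ := by rw [hp]; field_simp
  refine ⟨IK / n, ?_, ?_⟩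
  · have h1 : Bexp p univ (Mc (n := n)) / n - (γ / 2 - s / 2 * (IK / n)) =
        ((Bexp p univ (Mc (n := n)) - ((Fintype.card (Ed n) : ℝ) * p / 2 - s / 2 * IK)) - γ / 2) / n := by
      rw [card_Ed]
      have : (n:ℝ) * (n - 1) / 2 * p / 2 = γ * (n - 1) / 2 := by
        rw [show (n:ℝ) * (n - 1) / 2 * p / 2 = (p * n) * (n - 1) / 4 by ring, hpn]; ring
      rw [this]; field_simp; ring
    rw [h1, abs_div, abs_of_pos hn']
    apply div_le_div_of_nonneg_right _ hn'.le
    refine (abs_sub _ _).trans ?_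
    rw [abs_of_pos (by linarith : 0 < γ / 2)]
    linarith
  · have e1 : |IK - IB| ≤ n * (1 / β + β ^ 2 / Real.sqrt γ + β ^ 2 * c3 / Real.sqrt n) := by
      refine hu.trans ?_
      have t1 : Real.log (bis n).card / β ≤ n * (1 / β) := by
        rw [mul_one_div]
        apply div_le_div_of_nonneg_right _ hβ.le
        have := mul_le_mul_of_nonneg_left log2_le hn'.le
        linarith
      have t2 : (Fintype.card (Ed n) : ℝ) ≤ n ^ 2 / 2 := by
        rw [card_Ed]; nlinarith
      have t3 : 1 / (n * s) ≤ 1 / (n * Real.sqrt γ) := by gcongr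
      have t4 : |(Real.sqrt n)⁻¹| ^ 3 * c3 = c3 / (n * Real.sqrt n) := by
        rw [abs_of_pos (by positivity), inv_pow, pow_succ, hsn2]; field_simp
      rw [t4]
      have c3n := c3_nonneg
      have t5 : (Fintype.card (Ed n) : ℝ) * (2 * β ^ 2 * (1 / (n * s) + c3 / (n * Real.sqrt n))) ≤
          n ^ 2 / 2 * (2 * β ^ 2 * (1 / (n * Real.sqrt γ) + c3 / (n * Real.sqrt n))) := by
        gcongr
      have t6 : (n:ℝ) ^ 2 / 2 * (2 * β ^ 2 * (1 / (n * Real.sqrt γ) + c3 / (n * Real.sqrt n))) =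
          n * (β ^ 2 / Real.sqrt γ + β ^ 2 * c3 / Real.sqrt n) := by field_simp
      linarith
    have e2 : |IB - IA| ≤ n * (2 / l + 2 * l / Real.sqrt n) := by
      rw [abs_sub_comm, abs_of_nonneg (by linarith)]
      refine hbal.trans ?_
      have t1 : 2 * n * Real.log 2 / l ≤ n * (2 / l) := by
        rw [← mul_div_assoc]
        apply div_le_div_of_nonneg_right _ hl.le
        have := mul_le_mul_of_nonneg_left log2_le hn'.le
        linarith
      have t2 : 2 * l * Real.sqrt n = n * (2 * l / Real.sqrt n) := by
        field_simp; rw [hsn2]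
      linarith
    have e3 : IK / n - an n = ((IK - IB) + (IB - IA)) / n := by
      unfold an; rw [← hIA]; field_simp; ring
    rw [e3, abs_div, abs_of_pos hn', div_le_iff₀ hn']
    refine (abs_add_le _ _).trans ?_
    linarith

theorem mean_asymp (P : ℝ) (hP : Tendsto an atTop (nhds P)) (δ : ℝ) (hδ : 0 < δ) :
    ∃ γ₁ > 0, ∀ γ ≥ γ₁, ∀ᶠ n : ℕ in atTop,
      |Bexp (2 * γ / n) univ (Mc (n := n)) / n - (γ / 2 - P * Real.sqrt (γ / 2))| ≤ δ * Real.sqrt γ := by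
  set η := δ / 8 with hη
  have hη0 : 0 < η := by positivity
  refine ⟨1 / η ^ 6, by positivity, ?_⟩
  intro γ hγ
  have hγ0 : 0 < γ := lt_of_lt_of_le (by positivity) hγ
  have hg0 : 0 < Real.sqrt γ := Real.sqrt_pos.2 hγ0
  have hsq : 1 / η ^ 3 ≤ Real.sqrt γ := by
    apply Real.le_sqrt_of_sq_le
    refine le_trans (le_of_eq ?_) hγ
    field_simp
  have hcast : Tendsto (fun n : ℕ => (n:ℝ)) atTop atTop := tendsto_natCast_atTop_atTop
  have hsqrt : Tendsto (fun n : ℕ => Real.sqrt n) atTop atTop := Real.tendsto_sqrt_atTop.comp hcast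
  have v1 : ∀ᶠ n : ℕ in atTop, |an n - P| < η := by
    have := Metric.tendsto_nhds.1 hP η hη0
    simpa [Real.dist_eq] using this
  have v2 : ∀ᶠ n : ℕ in atTop, 2 * (2 / η) / Real.sqrt n ≤ η :=
    (hsqrt.const_div_atTop _).eventually_le_const hη0
  have v3 : ∀ᶠ n : ℕ in atTop, (1 / η) ^ 2 * c3 / Real.sqrt n ≤ η :=
    (hsqrt.const_div_atTop _).eventually_le_const hη0
  have v4 : ∀ᶠ n : ℕ in atTop, γ / n ≤ η * Real.sqrt γ :=
    (hcast.const_div_atTop _).eventually_le_const (by positivity)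
  have v5 : ∀ᶠ n : ℕ in atTop, |Real.sqrt (2 * γ * (1 - 2 * γ / n)) - Real.sqrt (2 * γ)| * (|P| / 2) ≤ η * Real.sqrt γ := by
    have : Tendsto (fun n : ℕ => |Real.sqrt (2 * γ * (1 - 2 * γ / n)) - Real.sqrt (2 * γ)| * (|P| / 2)) atTop
        (nhds (|Real.sqrt (2 * γ * (1 - 0)) - Real.sqrt (2 * γ)| * (|P| / 2))) := by
      have h0 : Tendsto (fun n : ℕ => 2 * γ / (n:ℝ)) atTop (nhds 0) := hcast.const_div_atTop _
      exact ((((Real.continuous_sqrt.tendsto _).comp ((h0.const_sub 1).const_mul (2 * γ))).sub_const _).abs).mul_const _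
    rw [sub_zero, mul_one, sub_self, abs_zero, zero_mul] at this
    exact this.eventually_le_const (by positivity)
  filter_upwards [v1, v2, v3, v4, v5, hcast.eventually_ge_atTop (4 * γ), eventually_gt_atTop 0] with n w1 w2 w3 w4 w5 w6 w7
  obtain ⟨c, hc1, hc2⟩ := finite_n n w7 γ hγ0 w6 (1 / η) (2 / η) (by positivity) (by positivity)
  have z1 : 2 / (2 / η) = η := by field_simp
  have z2 : 1 / (1 / η) = η := by field_simp
  have z3 : (1 / η) ^ 2 / Real.sqrt γ ≤ η := by
    rw [div_le_iff₀ hg0]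
    have := mul_le_mul_of_nonneg_left hsq hη0.le
    refine le_trans (le_of_eq ?_) this
    field_simp
  rw [z1, z2] at hc2
  have hcP : |c - P| ≤ 6 * η := by
    have := abs_sub_le c (an n) P
    linarith
  set s := Real.sqrt (2 * γ * (1 - 2 * γ / n)) with hs
  have hn' : (0:ℝ) < n := by exact_mod_cast w7
  have hs_le : s ≤ 2 * Real.sqrt γ := by
    rw [hs, Real.sqrt_le_left (by positivity), mul_pow, Real.sq_sqrt hγ0.le]
    have : 0 ≤ 2 * γ / n := by positivity
    nlinarith
  have hs0 : 0 ≤ s := Real.sqrt_nonneg _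
  have h2 : Real.sqrt (γ / 2) = Real.sqrt (2 * γ) / 2 := by
    rw [Real.sqrt_eq_iff_mul_self_eq (by positivity) (by positivity)]
    have := Real.mul_self_sqrt (show 0 ≤ 2 * γ by linarith)
    nlinarith
  have key : Bexp (2 * γ / n) univ (Mc (n := n)) / n - (γ / 2 - P * Real.sqrt (γ / 2)) =
      (Bexp (2 * γ / n) univ (Mc (n := n)) / n - (γ / 2 - s / 2 * c)) - s / 2 * (c - P) - (s - Real.sqrt (2 * γ)) * (P / 2) := by
    rw [h2]; ring
  rw [key]
  have q1 : |s / 2 * (c - P)| ≤ Real.sqrt γ * (6 * η) := by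
    rw [abs_mul, abs_of_nonneg (by linarith)]
    gcongr
    linarith
  have q2 : |(s - Real.sqrt (2 * γ)) * (P / 2)| ≤ η * Real.sqrt γ := by
    rw [abs_mul, abs_div, abs_two]
    exact w5
  refine (abs_sub _ _).trans ?_
  have q3 := abs_sub (Bexp (2 * γ / n) univ (Mc (n := n)) / n - (γ / 2 - s / 2 * c)) (s / 2 * (c - P))
  have : δ = 8 * η := by rw [hη]; ring
  rw [this]
  linarith


theorem cheb_gen (n : ℕ) (hn : 0 < n) (γ : ℝ) (hγ : 0 < γ) (h2 : 2 * γ ≤ n) (f : Finset (Ed n) → ℝ)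
    (hf : ∀ a A, |f (insert a A) - f A| ≤ 1) (t : ℝ) (ht : 0 < t) :
    Bpr (2 * γ / n) univ (fun A => n * t ≤ |f A - Bexp (2 * γ / n) univ f|) ≤ γ / (n * t ^ 2) := by
  have hn' : (0:ℝ) < n := by exact_mod_cast hn
  refine (Bpr_cheb (2 * γ / n) (by positivity) (by rw [div_le_one hn']; exact h2) univ f hf (n * t) (by positivity)).trans ?_
  rw [card_univ, card_Ed, div_le_div_iff₀ (by positivity) (by positivity)]
  have : (n:ℝ) * (n - 1) / 2 * (2 * γ / n) = γ * (n - 1) := by field_simp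
  rw [this]
  have h3 : 0 < γ * (n * t ^ 2) := by positivity
  nlinarith

theorem card_lip {n : ℕ} (a : Ed n) (A : Finset (Ed n)) : |((insert a A).card : ℝ) - A.card| ≤ 1 := by
  have h1 := Finset.card_insert_le a A
  have h2 := Finset.card_le_card (Finset.subset_insert a A)
  have h1' : ((insert a A).card : ℝ) ≤ A.card + 1 := by exact_mod_cast h1
  have h2' : (A.card : ℝ) ≤ (insert a A).card := by exact_mod_cast h2
  rw [abs_le]; constructor <;> linarith

theorem card_mean (n : ℕ) (hn : 0 < n) (γ : ℝ) :
    Bexp (2 * γ / n) (univ : Finset (Ed n)) (fun A => (A.card : ℝ)) = γ * (n - 1) := by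
  have hn' : (0:ℝ) < n := by exact_mod_cast hn
  rw [Bexp_card, card_univ, card_Ed]
  field_simp

/-- half-mass bound for the number of edges -/
theorem card_half (n : ℕ) (hn : 0 < n) (γ : ℝ) (hγ : 0 < γ) (h2 : 8 * γ ≤ n) (K : Finset (Ed n) → Prop)
    (hK : ∀ A, ¬ K A → (n:ℝ) * (1 / 2) ≤ |(A.card : ℝ) - γ * (n - 1)|) :
    1 / 2 ≤ Bpr (2 * γ / n) univ K := by
  have hn' : (0:ℝ) < n := by exact_mod_cast hn
  have h := cheb_gen n hn γ hγ (by linarith) (fun A => (A.card : ℝ)) card_lip (1 / 2) (by norm_num)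
  rw [card_mean n hn γ] at h
  have h1 := Bpr_mono (2 * γ / n) (by positivity) (by rw [div_le_one hn']; linarith) univ (fun A => ¬ K A) _ hK
  rw [Bpr_not] at h1
  have h3 : γ / (n * (1 / 2) ^ 2) ≤ 1 / 2 := by
    rw [div_le_iff₀ (by positivity)]; linarith
  linarith

theorem upper_tail (n : ℕ) (hn : 0 < n) (γ γ' x t : ℝ) (hγ' : γ' = γ + 1) (hγ : 0 < γ) (h8 : 8 * γ' ≤ n) (ht : 0 < t)
    (hx : Bexp (2 * γ' / n) univ (Mc (n := n)) / n + t ≤ x) :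
    qf (fun A : Finset (Ed n) => x < Mc A / n) ⌊γ * n⌋₊ ≤ 2 * (γ' / (n * t ^ 2)) := by
  have hn' : (0:ℝ) < n := by exact_mod_cast hn
  have hfl : (⌊γ * n⌋₊ : ℝ) ≤ γ * n := Nat.floor_le (by positivity)
  have hN : ⌊γ * n⌋₊ ≤ Fintype.card (Ed n) := by
    have : (⌊γ * n⌋₊ : ℝ) ≤ Fintype.card (Ed n) := by
      rw [card_Ed]; nlinarith
    exact_mod_cast this
  have hp0 : 0 ≤ 2 * γ' / n := by rw [hγ']; positivity
  have hp1 : 2 * γ' / n ≤ 1 := by rw [div_le_one hn']; linarith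
  have h1 := transfer_upper (2 * γ' / n) hp0 hp1 (fun A : Finset (Ed n) => x < Mc A / n)
    (fun A B hAB hA => lt_of_lt_of_le hA (div_le_div_of_nonneg_right (Mc_mono A B hAB) hn'.le)) ⌊γ * n⌋₊ hN
  have h2 := card_half n hn γ' (by linarith) h8 (fun A => ⌊γ * n⌋₊ ≤ A.card) (by
    intro A hA
    have hA' : (A.card : ℝ) ≤ ⌊γ * n⌋₊ := by exact_mod_cast (not_le.1 hA).le
    rw [le_abs]; right
    rw [hγ'] at h8 ⊢
    nlinarith)
  have h3 := cheb_gen n hn γ' (by linarith) (by linarith) Mc Mc_lip t ht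
  have h4 := Bpr_mono (2 * γ' / n) hp0 hp1 univ (fun A : Finset (Ed n) => x < Mc A / n)
    (fun A => n * t ≤ |Mc A - Bexp (2 * γ' / n) univ Mc|) (by
      intro A hA
      rw [le_abs]; left
      have h5 := lt_of_le_of_lt hx hA
      rw [← lt_sub_iff_add_lt', ← sub_div, lt_div_iff₀ hn'] at h5
      linarith)
  have h6 := qf_nonneg (fun A : Finset (Ed n) => x < Mc A / n) ⌊γ * n⌋₊
  generalize γ' / (n * t ^ 2) = V at h3 ⊢
  nlinarith

theorem lower_tail (n : ℕ) (hn : 0 < n) (γ γ' x t : ℝ) (hγ' : γ' = γ - 1) (hγ : 0 < γ') (h8 : 8 * γ' ≤ n) (ht : 0 < t)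
    (hx : x ≤ Bexp (2 * γ' / n) univ (Mc (n := n)) / n - t) :
    qf (fun A : Finset (Ed n) => Mc A / n < x) ⌊γ * n⌋₊ ≤ 2 * (γ' / (n * t ^ 2)) := by
  have hn' : (0:ℝ) < n := by exact_mod_cast hn
  have hfl : γ * n < (⌊γ * n⌋₊ : ℝ) + 1 := Nat.lt_floor_add_one _
  have hp0 : 0 ≤ 2 * γ' / n := by positivity
  have hp1 : 2 * γ' / n ≤ 1 := by rw [div_le_one hn']; linarith
  have h1 := transfer_lower (2 * γ' / n) hp0 hp1 (fun A : Finset (Ed n) => Mc A / n < x)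
    (fun A B hAB hA => lt_of_le_of_lt (div_le_div_of_nonneg_right (Mc_mono A B hAB) hn'.le) hA) ⌊γ * n⌋₊
  have h2 := card_half n hn γ' (by linarith) h8 (fun A => A.card ≤ ⌊γ * n⌋₊) (by
    intro A hA
    have hA' : (⌊γ * n⌋₊ : ℝ) + 1 ≤ A.card := by exact_mod_cast (not_le.1 hA)
    rw [le_abs]; left
    have : γ = γ' + 1 := by linarith
    rw [this] at hfl hA'
    nlinarith)
  have h3 := cheb_gen n hn γ' (by linarith) (by linarith) Mc Mc_lip t ht
  have h4 := Bpr_mono (2 * γ' / n) hp0 hp1 univ (fun A : Finset (Ed n) => Mc A / n < x)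
    (fun A => n * t ≤ |Mc A - Bexp (2 * γ' / n) univ Mc|) (by
      intro A hA
      rw [le_abs]; right
      have h5 := lt_of_lt_of_le hA hx
      rw [lt_sub_iff_add_lt, ← lt_sub_iff_add_lt', ← sub_div, lt_div_iff₀ hn'] at h5
      linarith)
  have h6 := qf_nonneg (fun A : Finset (Ed n) => Mc A / n < x) ⌊γ * n⌋₊
  generalize γ' / (n * t ^ 2) = V at h3 ⊢
  nlinarith

theorem sqrt_close (a b : ℝ) (hb : 0 ≤ b) (hab : b ≤ a) (h : a - b ≤ 1) : |Real.sqrt a - Real.sqrt b| ≤ 1 := by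
  rw [abs_of_nonneg (sub_nonneg.2 (Real.sqrt_le_sqrt hab))]
  have h1 : Real.sqrt a ≤ Real.sqrt b + 1 := by
    rw [Real.sqrt_le_left (by positivity)]
    have := Real.sq_sqrt hb
    nlinarith [Real.sqrt_nonneg b]
  linarith

/-- **Minimum bisection of sparse Erdős–Rényi graphs.**
If `P_*` is the limit of `n⁻¹ E[max_σ (-H^SK_n(σ))]` (which exists by the Parisi
formula), then for every `ε > 0` there is `γ₀` such that for all `γ ≥ γ₀`,
the minimum bisection of a uniformly random simple graph on `n` vertices with
`⌊γ n⌋` edges satisfies, w.h.p. as `n → ∞`,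
`mcut(G)/n = γ/2 − P_* √(γ/2) + o_γ(√γ)`. -/
theorem min_bisection_ER
    (Pstar : ℝ)
    (hP : Tendsto (fun n : ℕ =>
        (n : ℝ)⁻¹ * ∫ J, (⨆ σ : Fin n → Bool, -HSK n J σ) ∂(skMeasure n))
      atTop (nhds Pstar)) :
    ∀ ε > (0 : ℝ), ∃ γ₀ : ℝ, ∀ γ ≥ γ₀,
      Tendsto (fun n : ℕ =>
          probUniform {G : SimpleGraph (Fin n) | G.edgeSet.ncard = ⌊γ * n⌋₊}
            {G : SimpleGraph (Fin n) |
              |(mcut G : ℝ) / n - (γ / 2 - Pstar * Real.sqrt (γ / 2))|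
                ≤ ε * Real.sqrt γ})
        atTop (nhds 1) := by
  intro ε hε
  have hP' : Tendsto an atTop (nhds Pstar) := by
    refine hP.congr' ?_
    filter_upwards [eventually_gt_atTop 0] with n hn
    unfold an
    rw [SK_eq n hn]
  obtain ⟨γ₁, hγ₁, hmean⟩ := mean_asymp Pstar hP' (ε / 8) (by positivity)
  refine ⟨max (γ₁ + 1) (max 1 (((1 / 2 + |Pstar|) * (4 / ε)) ^ 2)), ?_⟩
  intro γ hγ
  have hγa : γ₁ + 1 ≤ γ := (le_max_left _ _).trans hγ
  have hγb : 1 ≤ γ := ((le_max_left _ _).trans (le_max_right _ _)).trans hγ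
  have hγc : ((1 / 2 + |Pstar|) * (4 / ε)) ^ 2 ≤ γ := ((le_max_right _ _).trans (le_max_right _ _)).trans hγ
  have hg0 : 0 < Real.sqrt γ := Real.sqrt_pos.2 (by linarith)
  have hPg : 1 / 2 + |Pstar| ≤ ε / 4 * Real.sqrt γ := by
    have := Real.le_sqrt_of_sq_le hγc
    rw [← mul_div_assoc, div_le_iff₀ hε] at this
    linarith
  set F := γ / 2 - Pstar * Real.sqrt (γ / 2) with hF
  set t := ε / 4 * Real.sqrt γ with ht
  have ht0 : 0 < t := by positivity
  have r1 : Real.sqrt (γ + 1) ≤ 2 * Real.sqrt γ := by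
    rw [Real.sqrt_le_left (by positivity), mul_pow, Real.sq_sqrt (by linarith)]; linarith
  have r2 : Real.sqrt (γ - 1) ≤ 2 * Real.sqrt γ := by
    have := Real.sqrt_le_sqrt (show γ - 1 ≤ γ by linarith)
    linarith
  have s1 : |Pstar * (Real.sqrt ((γ + 1) / 2) - Real.sqrt (γ / 2))| ≤ |Pstar| := by
    rw [abs_mul]
    have := sqrt_close ((γ + 1) / 2) (γ / 2) (by linarith) (by linarith) (by linarith)
    exact mul_le_of_le_one_right (abs_nonneg _) this
  have s2 : |Pstar * (Real.sqrt (γ / 2) - Real.sqrt ((γ - 1) / 2))| ≤ |Pstar| := by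
    rw [abs_mul]
    have := sqrt_close (γ / 2) ((γ - 1) / 2) (by linarith) (by linarith) (by linarith)
    exact mul_le_of_le_one_right (abs_nonneg _) this
  have hcast : Tendsto (fun n : ℕ => (n:ℝ)) atTop atTop := tendsto_natCast_atTop_atTop
  have hlow : ∀ᶠ n : ℕ in atTop, 1 - (2 * ((γ + 1) / t ^ 2) + 2 * ((γ - 1) / t ^ 2)) / n ≤
      qf (fun A : Finset (Ed n) => |Mc A / n - F| ≤ ε * Real.sqrt γ) ⌊γ * n⌋₊ := by
    filter_upwards [hmean (γ + 1) (by linarith), hmean (γ - 1) (by linarith), eventually_gt_atTop 0,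
      hcast.eventually_ge_atTop (8 * (γ + 1))] with n m1 m2 hn h8
    have hn' : (0:ℝ) < n := by exact_mod_cast hn
    have hu := upper_tail n hn γ (γ + 1) (F + ε * Real.sqrt γ) t rfl (by linarith) h8 ht0 (by
      generalize Bexp (2 * (γ + 1) / n) univ (Mc (n := n)) / n = E at m1 ⊢
      have e1 := (abs_le.1 m1).2
      have e2 := (abs_le.1 s1).1
      have e3 : ε / 8 * Real.sqrt (γ + 1) ≤ ε / 8 * (2 * Real.sqrt γ) := by gcongr
      linarith)
    have hl := lower_tail n hn γ (γ - 1) (F - ε * Real.sqrt γ) t rfl (by linarith) (by linarith) ht0 (by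
      generalize Bexp (2 * (γ - 1) / n) univ (Mc (n := n)) / n = E at m2 ⊢
      have e1 := (abs_le.1 m2).1
      have e2 := (abs_le.1 s2).1
      have e3 : ε / 8 * Real.sqrt (γ - 1) ≤ ε / 8 * (2 * Real.sqrt γ) := by gcongr
      linarith)
    have hfl : (⌊γ * n⌋₊ : ℝ) ≤ γ * n := Nat.floor_le (by positivity)
    have hN : ⌊γ * n⌋₊ ≤ Fintype.card (Ed n) := by
      have : (⌊γ * n⌋₊ : ℝ) ≤ Fintype.card (Ed n) := by
        rw [card_Ed]; nlinarith
      exact_mod_cast this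
    have hnot := qf_not (fun A : Finset (Ed n) => |Mc A / n - F| ≤ ε * Real.sqrt γ) _ hN
    have hor := qf_or (fun A : Finset (Ed n) => F + ε * Real.sqrt γ < Mc A / n) (fun A => Mc A / n < F - ε * Real.sqrt γ) ⌊γ * n⌋₊
    have himp := qf_imp (fun A : Finset (Ed n) => ¬ |Mc A / n - F| ≤ ε * Real.sqrt γ)
      (fun A => F + ε * Real.sqrt γ < Mc A / n ∨ Mc A / n < F - ε * Real.sqrt γ) ⌊γ * n⌋₊ (by
        intro A _ hA
        rw [not_le, lt_abs] at hA
        rcases hA with hA | hA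
        · left; linarith
        · right; linarith)
    have hid : (2 * ((γ + 1) / t ^ 2) + 2 * ((γ - 1) / t ^ 2)) / n = 2 * ((γ + 1) / (n * t ^ 2)) + 2 * ((γ - 1) / (n * t ^ 2)) := by
      field_simp
    rw [hid]
    linarith
  have hup : ∀ᶠ n : ℕ in atTop, qf (fun A : Finset (Ed n) => |Mc A / n - F| ≤ ε * Real.sqrt γ) ⌊γ * n⌋₊ ≤ 1 := by
    filter_upwards [eventually_gt_atTop 0, hcast.eventually_ge_atTop (8 * (γ + 1))] with n hn h8
    have hn' : (0:ℝ) < n := by exact_mod_cast hn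
    have hfl : (⌊γ * n⌋₊ : ℝ) ≤ γ * n := Nat.floor_le (by positivity)
    have hN : ⌊γ * n⌋₊ ≤ Fintype.card (Ed n) := by
      have : (⌊γ * n⌋₊ : ℝ) ≤ Fintype.card (Ed n) := by
        rw [card_Ed]; nlinarith
      exact_mod_cast this
    have hnot := qf_not (fun A : Finset (Ed n) => |Mc A / n - F| ≤ ε * Real.sqrt γ) _ hN
    have := qf_nonneg (fun A : Finset (Ed n) => ¬ |Mc A / n - F| ≤ ε * Real.sqrt γ) ⌊γ * n⌋₊
    linarith
  have hlim : Tendsto (fun n : ℕ => 1 - (2 * ((γ + 1) / t ^ 2) + 2 * ((γ - 1) / t ^ 2)) / (n:ℝ)) atTop (nhds 1) := by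
    have := (hcast.const_div_atTop (2 * ((γ + 1) / t ^ 2) + 2 * ((γ - 1) / t ^ 2))).const_sub 1
    simpa using this
  have hfin := tendsto_of_tendsto_of_tendsto_of_le_of_le' hlim tendsto_const_nhds hlow hup
  refine hfin.congr ?_
  intro n
  exact (probUniform_eq ⌊γ * n⌋₊ (fun G : SimpleGraph (Fin n) => |(mcut G : ℝ) / n - F| ≤ ε * Real.sqrt γ)).symm
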